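/- arXiv:2405.05326 — 3 statements merged into one kernel-verified Lean document; each statement's English description precedes it below -/
import Mathlib

section
/- If a tripartite state σ_{RQ'E'F} (with F an inert extension) satisfies I(R;E'|Q'F)_σ = 0, then for every unitary V acting on Q'⊗E', the state τ := (1_{RF} ⊗ V) σ (1_{RF} ⊗ V)† satisfies I(R;Q''F)_τ ≤ I(R;Q'F)_σ, i.e., no revival of mutual information between R and Q together with F can occur. -/
open Matrix
open scoped Kronecker Classical ComplexOrder

noncomputable section

/-- A density matrix: positive semidefinite with unit trace. -/
def IsState {n : Type*} [Fintype n] (ρ : Matrix n n ℂ) : Prop :=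
  ρ.PosSemidef ∧ ρ.trace = 1

def IsUnitaryM {n : Type*} [Fintype n] [DecidableEq n] (U : Matrix n n ℂ) : Prop :=
  U * Uᴴ = 1 ∧ Uᴴ * U = 1

/-- Von Neumann entropy, via the eigenvalues of a Hermitian matrix. -/
noncomputable def vN {n : Type*} [Fintype n] [DecidableEq n] (ρ : Matrix n n ℂ) : ℝ :=
  if h : ρ.IsHermitian then ∑ i, Real.negMulLog (h.eigenvalues i) else 0

/-- Partial trace over the second tensor factor. -/
def ptR {a b : Type*} [Fintype a] [Fintype b] (ρ : Matrix (a × b) (a × b) ℂ) :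
    Matrix a a ℂ := Matrix.of fun i j => ∑ k, ρ (i, k) (j, k)

/-- Partial trace over the first tensor factor. -/
def ptL {a b : Type*} [Fintype a] [Fintype b] (ρ : Matrix (a × b) (a × b) ℂ) :
    Matrix b b ℂ := Matrix.of fun i j => ∑ k, ρ (k, i) (k, j)

/-- Quantum mutual information I(A;B) of a bipartite state. -/
noncomputable def MI {a b : Type*} [Fintype a] [Fintype b] [DecidableEq a] [DecidableEq b]
    (ρ : Matrix (a × b) (a × b) ℂ) : ℝ :=
  vN (ptR ρ) + vN (ptL ρ) - vN ρ

/-- Marginal on the first two factors of a tripartite state on `a × (b × c)`. -/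
def mAB {a b c : Type*} [Fintype a] [Fintype b] [Fintype c]
    (ρ : Matrix (a × b × c) (a × b × c) ℂ) : Matrix (a × b) (a × b) ℂ :=
  Matrix.of fun i j => ∑ k, ρ (i.1, (i.2, k)) (j.1, (j.2, k))

/-- Marginal on the middle factor of a tripartite state on `a × (b × c)`. -/
def mB {a b c : Type*} [Fintype a] [Fintype b] [Fintype c]
    (ρ : Matrix (a × b × c) (a × b × c) ℂ) : Matrix b b ℂ :=
  Matrix.of fun i j => ∑ x : a, ∑ k : c, ρ (x, (i, k)) (x, (j, k))

/-- Marginal on the outer factors of a tripartite state on `a × (b × c)`. -/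
def mOuter {a b c : Type*} [Fintype a] [Fintype b] [Fintype c]
    (ρ : Matrix (a × b × c) (a × b × c) ℂ) : Matrix (a × c) (a × c) ℂ :=
  Matrix.of fun i j => ∑ k : b, ρ (i.1, (k, i.2)) (j.1, (k, j.2))

/-- Quantum conditional mutual information I(A;C|B) of a state on `a × (b × c)`:
`H(AB) + H(BC) - H(B) - H(ABC)`. -/
noncomputable def CMI {a b c : Type*} [Fintype a] [Fintype b] [Fintype c]
    [DecidableEq a] [DecidableEq b] [DecidableEq c]
    (ρ : Matrix (a × b × c) (a × b × c) ℂ) : ℝ :=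
  vN (mAB ρ) + vN (ptL ρ) - vN (mB ρ) - vN ρ

/-- Marginal on `R (Q F)` of a four-partite state on `R × (Q × (E × F))`. -/
def mRQF {R Q E F : Type*} [Fintype R] [Fintype Q] [Fintype E] [Fintype F]
    (σ : Matrix (R × Q × E × F) (R × Q × E × F) ℂ) : Matrix (R × Q × F) (R × Q × F) ℂ :=
  Matrix.of fun i j => ∑ e : E, σ (i.1, (i.2.1, (e, i.2.2))) (j.1, (j.2.1, (e, j.2.2)))

/-- Marginal on `(Q F)` of a four-partite state on `R × (Q × (E × F))`. -/
def mQF {R Q E F : Type*} [Fintype R] [Fintype Q] [Fintype E] [Fintype F]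
    (σ : Matrix (R × Q × E × F) (R × Q × E × F) ℂ) : Matrix (Q × F) (Q × F) ℂ :=
  Matrix.of fun i j => ∑ r : R, ∑ e : E, σ (r, (i.1, (e, i.2))) (r, (j.1, (e, j.2)))

/-- Marginal on `(R F)` of a four-partite state on `R × (Q × (E × F))`. -/
def mRF4 {R Q E F : Type*} [Fintype R] [Fintype Q] [Fintype E] [Fintype F]
    (σ : Matrix (R × Q × E × F) (R × Q × E × F) ℂ) : Matrix (R × F) (R × F) ℂ :=
  Matrix.of fun i j => ∑ q : Q, ∑ e : E, σ (i.1, (q, (e, i.2))) (j.1, (q, (e, j.2)))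

/-- Marginal on `F` of a four-partite state on `R × (Q × (E × F))`. -/
def mF4 {R Q E F : Type*} [Fintype R] [Fintype Q] [Fintype E] [Fintype F]
    (σ : Matrix (R × Q × E × F) (R × Q × E × F) ℂ) : Matrix F F ℂ :=
  Matrix.of fun i j => ∑ r : R, ∑ q : Q, ∑ e : E, σ (r, (q, (e, i))) (r, (q, (e, j)))

/-- Marginal on `R (Q E)` of a four-partite state on `R × (Q × (E × F))`. -/
def mRQE4 {R Q E F : Type*} [Fintype R] [Fintype Q] [Fintype E] [Fintype F]
    (σ : Matrix (R × Q × E × F) (R × Q × E × F) ℂ) : Matrix (R × Q × E) (R × Q × E) ℂ :=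
  Matrix.of fun i j => ∑ f : F, σ (i.1, (i.2.1, (i.2.2, f))) (j.1, (j.2.1, (j.2.2, f)))

/-- Marginal on `(R Q)` of a four-partite state on `R × (Q × (E × F))`. -/
def mRQ4 {R Q E F : Type*} [Fintype R] [Fintype Q] [Fintype E] [Fintype F]
    (σ : Matrix (R × Q × E × F) (R × Q × E × F) ℂ) : Matrix (R × Q) (R × Q) ℂ :=
  Matrix.of fun i j => ∑ e : E, ∑ f : F, σ (i.1, (i.2, (e, f))) (j.1, (j.2, (e, f)))

/-- Conditional mutual information I(R;E|QF) of a four-partite state on `R × (Q × (E × F))`. -/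
noncomputable def IREQF {R Q E F : Type*} [Fintype R] [Fintype Q] [Fintype E] [Fintype F]
    [DecidableEq R] [DecidableEq Q] [DecidableEq E] [DecidableEq F]
    (σ : Matrix (R × Q × E × F) (R × Q × E × F) ℂ) : ℝ :=
  vN (mRQF σ) + vN (ptL σ) - vN (mQF σ) - vN σ

/-- Lift a unitary acting on `Q × E` to the full space `R × (Q × (E × F))`, acting as the
identity on `R` and `F`. -/
def liftQE {R Q E F : Type*} [Fintype R] [Fintype Q] [Fintype E] [Fintype F]
    [DecidableEq R] [DecidableEq Q] [DecidableEq E] [DecidableEq F]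
    (V : Matrix (Q × E) (Q × E) ℂ) : Matrix (R × Q × E × F) (R × Q × E × F) ℂ :=
  (1 : Matrix R R ℂ) ⊗ₖ ((V ⊗ₖ (1 : Matrix F F ℂ)).submatrix
    (Equiv.prodAssoc Q E F).symm (Equiv.prodAssoc Q E F).symm)

section NoRevivalAux

open Filter Topology

theorem aux_deriv {μ : Type*} [Fintype μ] (a b c : μ → ℝ) (ha : ∀ i, 0 ≤ a i)
    (hb : ∀ i, 0 < b i) (t : ℝ) (ht : 0 ≤ t) : HasDerivAt
      (fun t => ∑ i, a i * c i * (Real.log (b i + t * a i) - Real.log (b i)))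
      (∑ i, a i ^ 2 * c i / (b i + t * a i)) t := by
  apply HasDerivAt.fun_sum
  intro i _
  have hpos : 0 < b i + t * a i := by
    have := mul_nonneg ht (ha i); have := hb i; linarith
  have h1 : HasDerivAt (fun t : ℝ => b i + t * a i) (a i) t := by
    simpa using ((hasDerivAt_id t).mul_const (a i)).const_add (b i)
  have h2 := ((h1.log hpos.ne').sub_const (Real.log (b i))).const_mul (a i * c i)
  exact h2.congr_deriv (by ring)

theorem aux_lim {μ : Type*} [Fintype μ] (a b c : μ → ℝ) (ha : ∀ i, 0 ≤ a i)
    (hb : ∀ i, 0 < b i) :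
    Tendsto (fun t : ℝ => ∑ i, a i * c i * (Real.log (b i + t * a i) - Real.log (b i))
      - (∑ i, a i * c i) * Real.log t) atTop
      (𝓝 (∑ i, a i * c i * (Real.log (a i) - Real.log (b i)))) := by
  have : Tendsto (fun t : ℝ => ∑ i, a i * c i * (Real.log (b i * t⁻¹ + a i) - Real.log (b i)))
      atTop (𝓝 (∑ i, a i * c i * (Real.log (a i) - Real.log (b i)))) := by
    apply tendsto_finsetSum
    intro i _
    rcases (ha i).eq_or_lt with h | h
    · simp [← h]
    · apply Tendsto.const_mul
      apply Tendsto.sub_const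
      have : Tendsto (fun t : ℝ => b i * t⁻¹ + a i) atTop (𝓝 (a i)) := by
        simpa using (tendsto_inv_atTop_zero.const_mul (b i)).add_const (a i)
      exact this.log h.ne'
  refine this.congr' ?_
  filter_upwards [eventually_gt_atTop 0] with t ht
  rw [Finset.sum_mul, ← Finset.sum_sub_distrib]
  refine Finset.sum_congr rfl fun i _ => ?_
  have hp : 0 < b i * t⁻¹ + a i := by
    have := mul_pos (hb i) (inv_pos.2 ht); have := ha i; linarith
  have : b i + t * a i = t * (b i * t⁻¹ + a i) := by field_simp
  rw [this, Real.log_mul ht.ne' hp.ne']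
  ring

theorem aux_tr1 {k : Type*} [Fintype k] (A B : Matrix k k ℂ) :
    (Aᴴ * B * A).trace = (A * Aᴴ * B).trace := by
  rw [trace_mul_comm, Matrix.mul_assoc]

theorem aux_tr2 {k : Type*} [Fintype k] (A B : Matrix k k ℂ) :
    (A * B * Aᴴ).trace = (Aᴴ * A * B).trace := by
  rw [trace_mul_comm, Matrix.mul_assoc]

/-- A scalar comparison: resolvent-type inequalities for all `t ≥ 0` imply the logarithmic one. -/
theorem aux_log_compare {ι κ : Type*} [Fintype ι] [Fintype κ]
    (a b c : ι → ℝ) (a' b' c' : κ → ℝ)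
    (ha : ∀ i, 0 ≤ a i) (hb : ∀ i, 0 < b i) (ha' : ∀ i, 0 ≤ a' i) (hb' : ∀ i, 0 < b' i)
    (hF : ∀ t : ℝ, 0 ≤ t → ∑ i, a' i ^ 2 * c' i / (b' i + t * a' i)
      ≤ ∑ i, a i ^ 2 * c i / (b i + t * a i))
    (hs : ∑ i, a i * c i = ∑ i, a' i * c' i) :
    ∑ i, a' i * c' i * (Real.log (a' i) - Real.log (b' i))
      ≤ ∑ i, a i * c i * (Real.log (a i) - Real.log (b i)) := by
  have hmono : MonotoneOn (fun t : ℝ =>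
      (∑ i, a i * c i * (Real.log (b i + t * a i) - Real.log (b i)))
      - ∑ i, a' i * c' i * (Real.log (b' i + t * a' i) - Real.log (b' i))) (Set.Ici 0) := by
    have hd : ∀ t : ℝ, 0 ≤ t → HasDerivAt (fun t : ℝ =>
      (∑ i, a i * c i * (Real.log (b i + t * a i) - Real.log (b i)))
      - ∑ i, a' i * c' i * (Real.log (b' i + t * a' i) - Real.log (b' i))) _ t :=
      fun t ht => (aux_deriv a b c ha hb t ht).sub (aux_deriv a' b' c' ha' hb' t ht)
    apply monotoneOn_of_deriv_nonneg (convex_Ici 0)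
    · exact fun t ht => (hd t ht).continuousAt.continuousWithinAt
    · intro t ht
      rw [interior_Ici] at ht
      exact (hd t (le_of_lt ht)).differentiableAt.differentiableWithinAt
    · intro t ht
      rw [interior_Ici] at ht
      rw [(hd t (le_of_lt ht)).deriv]
      exact sub_nonneg.2 (hF t (le_of_lt ht))
  refine le_of_tendsto_of_tendsto (aux_lim a' b' c' ha' hb') (aux_lim a b c ha hb) ?_
  filter_upwards [eventually_ge_atTop 0] with t ht
  have := hmono (Set.mem_Ici.2 le_rfl) (Set.mem_Ici.2 ht) ht
  simp at this
  rw [hs]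
  linarith

/-- Evaluation of the quadratic functional in eigenbases. -/
theorem aux_J_eval {n : Type*} [Fintype n] [DecidableEq n] (U W Y : Matrix n n ℂ) (p q : n → ℝ)
    (hU : Uᴴ * U = 1) (hW : Wᴴ * W = 1) (t : ℝ) :
    (2 * ((W * Y * Uᴴ)ᴴ * (U * diagonal (fun i => (p i : ℂ)) * Uᴴ)).trace
      - ((W * Y * Uᴴ)ᴴ * (W * diagonal (fun i => (q i : ℂ)) * Wᴴ) * (W * Y * Uᴴ)).trace
      - t * ((W * Y * Uᴴ) * (U * diagonal (fun i => (p i : ℂ)) * Uᴴ) * (W * Y * Uᴴ)ᴴ).trace).re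
    = ∑ x : n × n, (2 * p x.2 * (star (Y x.1 x.2) * (Wᴴ * U) x.1 x.2).re
        - (q x.1 + t * p x.2) * Complex.normSq (Y x.1 x.2)) := by
  have e1 : ((W * Y * Uᴴ)ᴴ * (U * diagonal (fun i => (p i : ℂ)) * Uᴴ)).trace
      = (Yᴴ * (Wᴴ * U * diagonal (fun i => (p i : ℂ)))).trace := by
    have : (W * Y * Uᴴ)ᴴ * (U * diagonal (fun i => (p i : ℂ)) * Uᴴ)
      = U * (Yᴴ * (Wᴴ * U * diagonal (fun i => (p i : ℂ)))) * Uᴴ := by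
      simp only [conjTranspose_mul, conjTranspose_conjTranspose, Matrix.mul_assoc]
    rw [this, trace_mul_comm, ← Matrix.mul_assoc, hU, Matrix.one_mul]
  have e2 : ((W * Y * Uᴴ)ᴴ * (W * diagonal (fun i => (q i : ℂ)) * Wᴴ) * (W * Y * Uᴴ)).trace
      = (Yᴴ * (diagonal (fun i => (q i : ℂ)) * Y)).trace := by
    have : (W * Y * Uᴴ)ᴴ * (W * diagonal (fun i => (q i : ℂ)) * Wᴴ) * (W * Y * Uᴴ)
      = U * (Yᴴ * ((Wᴴ * W) * diagonal (fun i => (q i : ℂ)) * (Wᴴ * W) * Y)) * Uᴴ := by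
      simp only [conjTranspose_mul, conjTranspose_conjTranspose, Matrix.mul_assoc]
    rw [this, trace_mul_comm, ← Matrix.mul_assoc, hU, hW, Matrix.one_mul, Matrix.one_mul,
      Matrix.mul_one]
  have e3 : ((W * Y * Uᴴ) * (U * diagonal (fun i => (p i : ℂ)) * Uᴴ) * (W * Y * Uᴴ)ᴴ).trace
      = (Yᴴ * (Y * diagonal (fun i => (p i : ℂ)))).trace := by
    have : (W * Y * Uᴴ) * (U * diagonal (fun i => (p i : ℂ)) * Uᴴ) * (W * Y * Uᴴ)ᴴ
      = W * (Y * (Uᴴ * U) * diagonal (fun i => (p i : ℂ)) * (Uᴴ * U) * Yᴴ) * Wᴴ := by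
      simp only [conjTranspose_mul, conjTranspose_conjTranspose, Matrix.mul_assoc]
    rw [this, trace_mul_comm, ← Matrix.mul_assoc, hU, hW, Matrix.one_mul, Matrix.mul_one,
      Matrix.mul_one, trace_mul_comm]
  rw [e1, e2, e3]
  have tr : ∀ A B : Matrix n n ℂ, (Aᴴ * B).trace = ∑ x : n × n, star (A x.1 x.2) * B x.1 x.2 := by
    intro A B
    rw [Fintype.sum_prod_type_right]
    simp [trace, mul_apply]
  rw [tr, tr, tr, Finset.mul_sum, Finset.mul_sum, ← Finset.sum_sub_distrib,
    ← Finset.sum_sub_distrib, Complex.re_sum]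
  refine Finset.sum_congr rfl fun x _ => ?_
  simp only [mul_diagonal, diagonal_mul, Complex.normSq_apply, Complex.star_def]
  generalize (Wᴴ * U) x.1 x.2 = z
  generalize Y x.1 x.2 = y
  simp
  ring

theorem aux_scalar (y m : ℂ) (p s : ℝ) (hs : 0 < s) :
    2 * p * (star y * m).re - s * Complex.normSq y ≤ p ^ 2 * Complex.normSq m / s := by
  rw [le_div_iff₀ hs]
  simp only [Complex.normSq_apply, Complex.star_def, Complex.mul_re, Complex.conj_re,
    Complex.conj_im]
  nlinarith [sq_nonneg (p * m.re - s * y.re), sq_nonneg (p * m.im - s * y.im)]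

theorem aux_scalar_eq (m : ℂ) (p s : ℝ) (hs : 0 < s) :
    2 * p * (star (((p / s : ℝ) : ℂ) * m) * m).re - s * Complex.normSq (((p / s : ℝ) : ℂ) * m)
      = p ^ 2 * Complex.normSq m / s := by
  simp only [Complex.normSq_apply, Complex.star_def, Complex.mul_re, Complex.conj_re,
    Complex.conj_im, Complex.mul_im, Complex.ofReal_re, Complex.ofReal_im]
  field_simp
  ring

/-- Monotonicity of the quadratic resolvent functional under a (dual) embedding `L`. -/
theorem aux_F_mono {n m : Type*} [Fintype n] [DecidableEq n] [Fintype m] [DecidableEq m]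
    (U W : Matrix n n ℂ) (p q : n → ℝ) (U' W' : Matrix m m ℂ) (p' q' : m → ℝ)
    (hU : Uᴴ * U = 1) (hW : Wᴴ * W = 1) (hU' : U'ᴴ * U' = 1) (hW' : W'ᴴ * W' = 1)
    (hp : ∀ i, 0 ≤ p i) (hq : ∀ i, 0 < q i) (hp' : ∀ i, 0 ≤ p' i) (hq' : ∀ i, 0 < q' i)
    (L : Matrix m m ℂ → Matrix n n ℂ)
    (hL1 : ∀ X, L Xᴴ = (L X)ᴴ) (hL2 : ∀ X Y, L (X * Y) = L X * L Y)
    (hLρ : ∀ X, (L X * (U * diagonal (fun i => (p i : ℂ)) * Uᴴ)).trace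
      = (X * (U' * diagonal (fun i => (p' i : ℂ)) * U'ᴴ)).trace)
    (hLσ : ∀ X, (L X * (W * diagonal (fun i => (q i : ℂ)) * Wᴴ)).trace
      = (X * (W' * diagonal (fun i => (q' i : ℂ)) * W'ᴴ)).trace)
    (t : ℝ) (ht : 0 ≤ t) :
    ∑ x : m × m, p' x.2 ^ 2 * Complex.normSq ((W'ᴴ * U') x.1 x.2) / (q' x.1 + t * p' x.2)
     ≤ ∑ x : n × n, p x.2 ^ 2 * Complex.normSq ((Wᴴ * U) x.1 x.2) / (q x.1 + t * p x.2) := by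
  have hs : ∀ x : n × n, 0 < q x.1 + t * p x.2 := fun x => by
    have := mul_nonneg ht (hp x.2); have := hq x.1; linarith
  have hs' : ∀ x : m × m, 0 < q' x.1 + t * p' x.2 := fun x => by
    have := mul_nonneg ht (hp' x.2); have := hq' x.1; linarith
  set Y' : Matrix m m ℂ := Matrix.of fun j i =>
    (((p' i / (q' j + t * p' i) : ℝ)) : ℂ) * (W'ᴴ * U') j i with hY'
  have h1 := aux_J_eval U' W' Y' p' q' hU' hW' t
  have h2 : ∑ x : m × m, (2 * p' x.2 * (star (Y' x.1 x.2) * (W'ᴴ * U') x.1 x.2).re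
        - (q' x.1 + t * p' x.2) * Complex.normSq (Y' x.1 x.2))
      = ∑ x : m × m, p' x.2 ^ 2 * Complex.normSq ((W'ᴴ * U') x.1 x.2) / (q' x.1 + t * p' x.2) :=
    Finset.sum_congr rfl fun x _ => aux_scalar_eq _ _ _ (hs' x)
  rw [← h2, ← h1]
  set X' := W' * Y' * U'ᴴ
  set X := L X' with hX
  set Y := Wᴴ * X * U with hY
  have hWW : W * Wᴴ = 1 := mul_eq_one_comm.1 hW
  have hUU : U * Uᴴ = 1 := mul_eq_one_comm.1 hU
  have hXY : W * Y * Uᴴ = X := by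
    calc W * Y * Uᴴ = (W * Wᴴ) * X * (U * Uᴴ) := by rw [hY]; simp only [Matrix.mul_assoc]
      _ = X := by rw [hWW, hUU, Matrix.one_mul, Matrix.mul_one]
  have h3 := aux_J_eval U W Y p q hU hW t
  rw [hXY] at h3
  refine le_trans (le_of_eq ?_) (h3.le.trans (Finset.sum_le_sum fun x _ =>
    aux_scalar _ _ _ _ (hs x)))
  have k1 := hLρ X'ᴴ
  have k2 := hLσ (X' * X'ᴴ)
  have k3 := hLρ (X'ᴴ * X')
  rw [hL1, ← hX] at k1
  rw [hL2, hL1, ← hX] at k2 k3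
  rw [aux_tr1, aux_tr2, aux_tr1, aux_tr2, k1, k2, k3]

theorem aux_spectral {n : Type*} [Fintype n] [DecidableEq n] {A : Matrix n n ℂ}
    (hA : A.IsHermitian) :
    (hA.eigenvectorUnitary : Matrix n n ℂ) * diagonal (fun i => (hA.eigenvalues i : ℂ))
      * (hA.eigenvectorUnitary : Matrix n n ℂ)ᴴ = A := by
  have := hA.spectral_theorem
  rw [Unitary.conjStarAlgAut_apply] at this
  exact this.symm

theorem aux_unit {n : Type*} [Fintype n] [DecidableEq n] {A : Matrix n n ℂ}
    (hA : A.IsHermitian) :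
    (hA.eigenvectorUnitary : Matrix n n ℂ)ᴴ * (hA.eigenvectorUnitary : Matrix n n ℂ) = 1 := by
  have := Unitary.coe_star_mul_self hA.eigenvectorUnitary
  rwa [star_eq_conjTranspose] at this

theorem aux_vN_conj {n : Type*} [Fintype n] [DecidableEq n] (A U : Matrix n n ℂ)
    (hA : A.IsHermitian) (hU : Uᴴ * U = 1) : vN (U * A * Uᴴ) = vN A := by
  have hB : (U * A * Uᴴ).IsHermitian := isHermitian_mul_mul_conjTranspose U hA
  have : hB.eigenvalues = hA.eigenvalues := by
    rw [IsHermitian.eigenvalues_eq_eigenvalues_iff, charpoly_mul_comm, ← Matrix.mul_assoc, hU,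
      Matrix.one_mul]
  rw [vN, vN, dif_pos hB, dif_pos hA, this]

theorem aux_block {a b : Type*} [Fintype a] [Fintype b] [DecidableEq a]
    (ρ : Matrix (a × b) (a × b) ℂ) (A B : Matrix b b ℂ) (r r' : a) :
    (((1 : Matrix a a ℂ) ⊗ₖ A) * ρ * ((1 : Matrix a a ℂ) ⊗ₖ B)).submatrix (Prod.mk r) (Prod.mk r')
      = A * ρ.submatrix (Prod.mk r) (Prod.mk r') * B := by
  ext i j
  simp [mul_apply, Fintype.sum_prod_type, one_apply, Finset.sum_ite_irrel]

theorem aux_ptL_block {a b : Type*} [Fintype a] [Fintype b] (ρ : Matrix (a × b) (a × b) ℂ) :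
    ptL ρ = ∑ r, ρ.submatrix (Prod.mk r) (Prod.mk r) := by
  ext i j
  simp [ptL, Matrix.sum_apply]

theorem aux_ptR_block {a b : Type*} [Fintype a] [Fintype b] (ρ : Matrix (a × b) (a × b) ℂ)
    (r r' : a) : ptR ρ r r' = (ρ.submatrix (Prod.mk r) (Prod.mk r')).trace := by
  simp [ptR, trace]

theorem aux_ptL_conj {a b : Type*} [Fintype a] [Fintype b] [DecidableEq a]
    (ρ : Matrix (a × b) (a × b) ℂ) (A B : Matrix b b ℂ) :
    ptL (((1 : Matrix a a ℂ) ⊗ₖ A) * ρ * ((1 : Matrix a a ℂ) ⊗ₖ B)) = A * ptL ρ * B := by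
  rw [aux_ptL_block, aux_ptL_block, Finset.mul_sum, Finset.sum_mul]
  exact Finset.sum_congr rfl fun r _ => aux_block ρ A B r r

theorem aux_ptR_conj {a b : Type*} [Fintype a] [Fintype b] [DecidableEq a] [DecidableEq b]
    (ρ : Matrix (a × b) (a × b) ℂ) (A B : Matrix b b ℂ) (h : B * A = 1) :
    ptR (((1 : Matrix a a ℂ) ⊗ₖ A) * ρ * ((1 : Matrix a a ℂ) ⊗ₖ B)) = ptR ρ := by
  ext r r'
  rw [aux_ptR_block, aux_ptR_block, aux_block, trace_mul_comm, ← Matrix.mul_assoc, h,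
    Matrix.one_mul]

theorem aux_ptL_psd {a b : Type*} [Fintype a] [Fintype b] {ρ : Matrix (a × b) (a × b) ℂ}
    (h : ρ.PosSemidef) : (ptL ρ).PosSemidef := by
  rw [aux_ptL_block]
  exact posSemidef_sum _ fun r _ => h.submatrix _

theorem aux_colsum {n : Type*} [Fintype n] [DecidableEq n] (M : Matrix n n ℂ) (h : Mᴴ * M = 1)
    (i : n) : ∑ j, Complex.normSq (M j i) = 1 := by
  have := congrFun (congrFun h i) i
  rw [mul_apply, one_apply_eq] at this
  have h2 := congrArg Complex.re this
  rw [Complex.re_sum] at h2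
  rw [← Complex.one_re, ← h2]
  refine Finset.sum_congr rfl fun j _ => ?_
  simp [Complex.normSq_apply]

theorem aux_diag {n : Type*} [Fintype n] [DecidableEq n] (U W : Matrix n n ℂ) (p : n → ℝ) (j : n) :
    ∑ i, p i * Complex.normSq ((Wᴴ * U) j i)
      = ((Wᴴ * (U * diagonal (fun i => (p i : ℂ)) * Uᴴ) * W) j j).re := by
  have : Wᴴ * (U * diagonal (fun i => (p i : ℂ)) * Uᴴ) * W
      = (Wᴴ * U) * diagonal (fun i => (p i : ℂ)) * (Wᴴ * U)ᴴ := by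
    simp only [conjTranspose_mul, conjTranspose_conjTranspose, Matrix.mul_assoc]
  rw [this, mul_apply, Complex.re_sum]
  refine Finset.sum_congr rfl fun i _ => ?_
  rw [mul_diagonal, conjTranspose_apply]
  generalize (Wᴴ * U) j i = z
  simp [Complex.normSq_apply]
  ring

/-- Evaluation of the regularised relative entropy of `ρ` with respect to `1 ⊗ (ptL ρ + ε)`. -/
theorem aux_relent {a b : Type*} [Fintype a] [Fintype b] [DecidableEq a] [DecidableEq b]
    {ρ : Matrix (a × b) (a × b) ℂ} (hρ : ρ.IsHermitian) (hω : (ptL ρ).IsHermitian) (ε : ℝ) :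
    ∑ x : (a × b) × (a × b), hρ.eigenvalues x.2 *
      Complex.normSq ((((1 : Matrix a a ℂ) ⊗ₖ (hω.eigenvectorUnitary : Matrix b b ℂ))ᴴ
        * (hρ.eigenvectorUnitary : Matrix (a × b) (a × b) ℂ)) x.1 x.2)
      * (Real.log (hρ.eigenvalues x.2) - Real.log (hω.eigenvalues x.1.2 + ε))
    = - vN ρ - ∑ k, hω.eigenvalues k * Real.log (hω.eigenvalues k + ε) := by
  set U : Matrix (a × b) (a × b) ℂ := (hρ.eigenvectorUnitary : Matrix (a × b) (a × b) ℂ) with hUdef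
  set W' : Matrix b b ℂ := (hω.eigenvectorUnitary : Matrix b b ℂ) with hWdef
  set W : Matrix (a × b) (a × b) ℂ := (1 : Matrix a a ℂ) ⊗ₖ W' with hW
  have hU1 : Uᴴ * U = 1 := aux_unit hρ
  have hW1' : W'ᴴ * W' = 1 := aux_unit hω
  have hWH : Wᴴ = (1 : Matrix a a ℂ) ⊗ₖ W'ᴴ := by
    rw [hW, conjTranspose_kronecker, conjTranspose_one]
  have hW1 : Wᴴ * W = 1 := by
    rw [hWH, hW, ← mul_kronecker_mul, hW1', Matrix.one_mul, one_kronecker_one]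
  have hM : (Wᴴ * U)ᴴ * (Wᴴ * U) = 1 := by
    have hWW : W * Wᴴ = 1 := mul_eq_one_comm.1 hW1
    calc (Wᴴ * U)ᴴ * (Wᴴ * U) = Uᴴ * (W * Wᴴ) * U := by
          simp only [conjTranspose_mul, conjTranspose_conjTranspose, Matrix.mul_assoc]
      _ = 1 := by rw [hWW, Matrix.mul_one, hU1]
  simp_rw [mul_sub]
  rw [Finset.sum_sub_distrib]
  congr 1
  · rw [Fintype.sum_prod_type_right, vN, dif_pos hρ, ← Finset.sum_neg_distrib]
    refine Finset.sum_congr rfl fun i _ => ?_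
    simp only
    rw [← Finset.sum_mul, ← Finset.mul_sum, aux_colsum _ hM, Real.negMulLog]
    ring
  · rw [Fintype.sum_prod_type]
    simp only
    simp_rw [← Finset.sum_mul, aux_diag]
    rw [Fintype.sum_prod_type_right]
    refine Finset.sum_congr rfl fun k _ => ?_
    simp only
    rw [← Finset.sum_mul, aux_spectral hρ, ← Complex.re_sum]
    congr 1
    have h1 := aux_ptL_conj ρ W'ᴴ W'
    rw [← hWH, ← hW] at h1
    have h2 : W'ᴴ * ptL ρ * W' = diagonal (fun i => (hω.eigenvalues i : ℂ)) := by
      have h3 := aux_spectral hω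
      rw [← hWdef] at h3
      calc W'ᴴ * ptL ρ * W' = W'ᴴ * (W' * diagonal (fun i => (hω.eigenvalues i : ℂ)) * W'ᴴ) * W' := by
            rw [h3]
        _ = (W'ᴴ * W') * diagonal (fun i => (hω.eigenvalues i : ℂ)) * (W'ᴴ * W') := by
            simp only [Matrix.mul_assoc]
        _ = _ := by rw [hW1', Matrix.one_mul, Matrix.mul_one]
    have h4 := congrFun (congrFun (h1.trans h2) k) k
    rw [diagonal_apply_eq] at h4
    have h5 := congrArg Complex.re h4
    simpa [ptL] using h5

theorem aux_tot {n : Type*} [Fintype n] [DecidableEq n] (U W : Matrix n n ℂ) (p : n → ℝ)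
    (hU : Uᴴ * U = 1) (hW : W * Wᴴ = 1) :
    ∑ x : n × n, p x.2 * Complex.normSq ((Wᴴ * U) x.1 x.2) = ∑ i, p i := by
  have hM : (Wᴴ * U)ᴴ * (Wᴴ * U) = 1 := by
    calc (Wᴴ * U)ᴴ * (Wᴴ * U) = Uᴴ * (W * Wᴴ) * U := by
          simp only [conjTranspose_mul, conjTranspose_conjTranspose, Matrix.mul_assoc]
      _ = 1 := by rw [hW, Matrix.mul_one, hU]
  rw [Fintype.sum_prod_type_right]
  refine Finset.sum_congr rfl fun i _ => ?_
  simp only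
  rw [← Finset.mul_sum, aux_colsum _ hM, mul_one]

/-- `1 ⊗ (A + ε)` diagonalised. -/
theorem aux_one_kron {a b : Type*} [Fintype a] [Fintype b] [DecidableEq a] [DecidableEq b]
    {A : Matrix b b ℂ} (hA : A.IsHermitian) (ε : ℝ) :
    ((1 : Matrix a a ℂ) ⊗ₖ (hA.eigenvectorUnitary : Matrix b b ℂ))
      * diagonal (fun x : a × b => ((hA.eigenvalues x.2 + ε : ℝ) : ℂ))
      * ((1 : Matrix a a ℂ) ⊗ₖ (hA.eigenvectorUnitary : Matrix b b ℂ))ᴴ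
    = (1 : Matrix a a ℂ) ⊗ₖ (A + (ε : ℂ) • 1) := by
  have h3 := aux_spectral hA
  have h4 := aux_unit hA
  set W := (hA.eigenvectorUnitary : Matrix b b ℂ)
  have h5 : W * Wᴴ = 1 := mul_eq_one_comm.1 h4
  have hd : diagonal (fun x : a × b => ((hA.eigenvalues x.2 + ε : ℝ) : ℂ))
      = (1 : Matrix a a ℂ) ⊗ₖ (diagonal (fun i => (hA.eigenvalues i : ℂ)) + (ε : ℂ) • 1) := by
    rw [← diagonal_one, ← diagonal_one, ← diagonal_smul, diagonal_add,
      diagonal_kronecker_diagonal]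
    congr 1
    ext x
    simp
  rw [hd, conjTranspose_kronecker, conjTranspose_one, ← mul_kronecker_mul, ← mul_kronecker_mul,
    Matrix.one_mul, Matrix.one_mul, Matrix.mul_add, Matrix.add_mul, h3, Matrix.mul_smul,
    Matrix.smul_mul, Matrix.mul_one, h5]

/-- Reordering of tensor factors. -/
def auxEquiv (R Q E F : Type*) : R × Q × E × F ≃ (R × Q × F) × E where
  toFun x := ((x.1, x.2.1, x.2.2.2), x.2.2.1)
  invFun y := (y.1.1, y.1.2.1, y.2, y.1.2.2)
  left_inv _ := rfl
  right_inv _ := rfl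

theorem aux_ptL_mRQF {R Q E F : Type*} [Fintype R] [Fintype Q] [Fintype E] [Fintype F]
    (σ : Matrix (R × Q × E × F) (R × Q × E × F) ℂ) : ptL (mRQF σ) = mQF σ := rfl

theorem aux_mRQF_eq {R Q E F : Type*} [Fintype R] [Fintype Q] [Fintype E] [Fintype F]
    (σ : Matrix (R × Q × E × F) (R × Q × E × F) ℂ) :
    mRQF σ = ptR (σ.submatrix (auxEquiv R Q E F).symm (auxEquiv R Q E F).symm) := rfl

theorem aux_mRQF_psd {R Q E F : Type*} [Fintype R] [Fintype Q] [Fintype E] [Fintype F]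
    {σ : Matrix (R × Q × E × F) (R × Q × E × F) ℂ} (h : σ.PosSemidef) : (mRQF σ).PosSemidef := by
  have : mRQF σ = ∑ e : E, σ.submatrix (fun i : R × Q × F => (i.1, i.2.1, e, i.2.2))
      (fun i : R × Q × F => (i.1, i.2.1, e, i.2.2)) := by
    ext i j
    simp [mRQF, Matrix.sum_apply]
  rw [this]
  exact posSemidef_sum _ fun e _ => h.submatrix _

theorem aux_ptR_mRQF {R Q E F : Type*} [Fintype R] [Fintype Q] [Fintype E] [Fintype F]
    (σ : Matrix (R × Q × E × F) (R × Q × E × F) ℂ) : ptR (mRQF σ) = ptR σ := by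
  ext r r'
  simp only [ptR, mRQF, of_apply, Fintype.sum_prod_type]
  exact Finset.sum_congr rfl fun q _ => Finset.sum_comm

theorem aux_mRQF_kron {R Q E F : Type*} [Fintype R] [Fintype Q] [Fintype E] [Fintype F]
    [DecidableEq R] [DecidableEq Q] [DecidableEq E] [DecidableEq F]
    (σ : Matrix (R × Q × E × F) (R × Q × E × F) ℂ) (ε : ℂ) :
    mRQF ((1 : Matrix R R ℂ) ⊗ₖ (ptL σ + ε • 1))
      = (1 : Matrix R R ℂ) ⊗ₖ (ptL (mRQF σ) + ((Fintype.card E : ℂ) * ε) • 1) := by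
  ext ⟨r, q, f⟩ ⟨r', q', f'⟩
  simp only [mRQF, ptL, of_apply, kroneckerMap_apply, Matrix.add_apply, Matrix.smul_apply, smul_eq_mul]
  change ∑ x : E, (1 : Matrix R R ℂ) r r' * (∑ y, σ (y, q, x, f) (y, q', x, f')
    + ε * (1 : Matrix (Q × E × F) (Q × E × F) ℂ) (q, x, f) (q', x, f')) = _
  rw [← Finset.mul_sum, Finset.sum_add_distrib, Finset.sum_comm]
  congr 2
  simp [one_apply, Prod.ext_iff]

/-- The ampliation `X ↦ X ⊗ 1_E`. -/
def auxL {R Q E F : Type*} [DecidableEq E] (X : Matrix (R × Q × F) (R × Q × F) ℂ) :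
    Matrix (R × Q × E × F) (R × Q × E × F) ℂ :=
  (X ⊗ₖ (1 : Matrix E E ℂ)).submatrix (auxEquiv R Q E F) (auxEquiv R Q E F)

theorem auxL_trace {R Q E F : Type*} [Fintype R] [Fintype Q] [Fintype E] [Fintype F]
    [DecidableEq E] (X : Matrix (R × Q × F) (R × Q × F) ℂ)
    (σ : Matrix (R × Q × E × F) (R × Q × E × F) ℂ) :
    (auxL X * σ).trace = (X * mRQF σ).trace := by
  have h1 : (auxL X * σ).trace = ((X ⊗ₖ (1 : Matrix E E ℂ))
      * σ.submatrix (auxEquiv R Q E F).symm (auxEquiv R Q E F).symm).trace := by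
    simp only [trace, diag_apply, mul_apply]
    refine Fintype.sum_equiv (auxEquiv R Q E F) _ _ fun i => ?_
    exact Fintype.sum_equiv (auxEquiv R Q E F) _ _ fun j => rfl
  rw [h1, aux_mRQF_eq]
  generalize σ.submatrix (auxEquiv R Q E F).symm (auxEquiv R Q E F).symm = τ
  simp only [trace, diag_apply, mul_apply, ptR, of_apply, Fintype.sum_prod_type (γ := ℂ)
    (α₁ := R × Q × F), kroneckerMap_apply, one_apply, mul_ite, mul_one, mul_zero, ite_mul, zero_mul,
    Finset.sum_ite_eq, Finset.mem_univ, if_true, Finset.mul_sum]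
  exact Finset.sum_congr rfl fun i _ => Finset.sum_comm

theorem auxL_conj {R Q E F : Type*} [DecidableEq E] (X : Matrix (R × Q × F) (R × Q × F) ℂ) :
    (auxL Xᴴ : Matrix (R × Q × E × F) (R × Q × E × F) ℂ) = (auxL X)ᴴ := by
  rw [auxL, auxL, conjTranspose_submatrix, conjTranspose_kronecker, conjTranspose_one]

theorem auxL_mul {R Q E F : Type*} [Fintype R] [Fintype Q] [Fintype E] [Fintype F]
    [DecidableEq E] (X Y : Matrix (R × Q × F) (R × Q × F) ℂ) :
    (auxL (X * Y) : Matrix (R × Q × E × F) (R × Q × E × F) ℂ) = auxL X * auxL Y := by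
  rw [auxL, auxL, auxL, submatrix_mul_equiv, ← mul_kronecker_mul, Matrix.one_mul]

theorem aux_trace_eig {n : Type*} [Fintype n] [DecidableEq n] {A : Matrix n n ℂ}
    (hA : A.IsHermitian) : ∑ i, hA.eigenvalues i = A.trace.re := by
  rw [hA.trace_eq_sum_eigenvalues]
  simp

theorem aux_kron_unit {a b : Type*} [Fintype a] [Fintype b] [DecidableEq a] [DecidableEq b]
    {W : Matrix b b ℂ} (h : Wᴴ * W = 1) :
    ((1 : Matrix a a ℂ) ⊗ₖ W)ᴴ * ((1 : Matrix a a ℂ) ⊗ₖ W) = 1 := by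
  rw [conjTranspose_kronecker, conjTranspose_one, ← mul_kronecker_mul, h, Matrix.one_mul,
    one_kronecker_one]

/-- Regularised strong subadditivity. -/
theorem aux_ssa_eps {R Q E F : Type*} [Fintype R] [Fintype Q] [Fintype E] [Fintype F]
    [DecidableEq R] [DecidableEq Q] [DecidableEq E] [DecidableEq F] [Nonempty E]
    {σ : Matrix (R × Q × E × F) (R × Q × E × F) ℂ} (hσ : σ.PosSemidef)
    (ε : ℝ) (hε : 0 < ε) :
    - vN (mRQF σ) - ∑ k, (aux_ptL_psd (aux_mRQF_psd hσ)).1.eigenvalues k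
        * Real.log ((aux_ptL_psd (aux_mRQF_psd hσ)).1.eigenvalues k + Fintype.card E * ε)
    ≤ - vN σ - ∑ k, (aux_ptL_psd hσ).1.eigenvalues k
        * Real.log ((aux_ptL_psd hσ).1.eigenvalues k + ε) := by
  have hσ' := aux_mRQF_psd hσ
  have hω := aux_ptL_psd hσ
  have hω' := aux_ptL_psd hσ'
  have hcard : (0 : ℝ) < Fintype.card E := by exact_mod_cast Fintype.card_pos
  have hq : ∀ i : R × Q × E × F, 0 < hω.1.eigenvalues i.2 + ε := fun i => by
    have := hω.eigenvalues_nonneg i.2; linarith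
  have hq' : ∀ i : R × Q × F, 0 < hω'.1.eigenvalues i.2 + Fintype.card E * ε := fun i => by
    have := hω'.eigenvalues_nonneg i.2; have := mul_pos hcard hε; linarith
  have hW := aux_kron_unit (a := R) (aux_unit hω.1)
  have hW' := aux_kron_unit (a := R) (aux_unit hω'.1)
  rw [← aux_relent hσ.1 hω.1 ε, ← aux_relent hσ'.1 hω'.1 (Fintype.card E * ε)]
  refine aux_log_compare (fun x : (R × Q × E × F) × (R × Q × E × F) => hσ.1.eigenvalues x.2)
    (fun x : (R × Q × E × F) × (R × Q × E × F) => hω.1.eigenvalues x.1.2 + ε) _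
    (fun x : (R × Q × F) × (R × Q × F) => hσ'.1.eigenvalues x.2)
    (fun x : (R × Q × F) × (R × Q × F) => hω'.1.eigenvalues x.1.2 + Fintype.card E * ε) _
    (fun x => hσ.eigenvalues_nonneg _) (fun x => hq x.1)
    (fun x => hσ'.eigenvalues_nonneg _) (fun x => hq' x.1) ?_ ?_
  · intro t ht
    refine aux_F_mono _ _ hσ.1.eigenvalues (fun i => hω.1.eigenvalues i.2 + ε) _ _
      hσ'.1.eigenvalues (fun i => hω'.1.eigenvalues i.2 + Fintype.card E * ε)
      (aux_unit hσ.1) hW (aux_unit hσ'.1) hW'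
      hσ.eigenvalues_nonneg hq hσ'.eigenvalues_nonneg hq' auxL auxL_conj auxL_mul ?_ ?_ t ht
    · intro X
      rw [aux_spectral, aux_spectral, auxL_trace]
    · intro X
      rw [aux_one_kron, aux_one_kron, auxL_trace, aux_mRQF_kron]
      simp
  · rw [aux_tot _ _ _ (aux_unit hσ.1) (mul_eq_one_comm.1 hW),
      aux_tot _ _ _ (aux_unit hσ'.1) (mul_eq_one_comm.1 hW'), aux_trace_eig, aux_trace_eig]
    have h1 := auxL_trace (1 : Matrix (R × Q × F) (R × Q × F) ℂ) σ
    have h2 : (auxL (1 : Matrix (R × Q × F) (R × Q × F) ℂ) :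
        Matrix (R × Q × E × F) (R × Q × E × F) ℂ) = 1 := by
      rw [auxL, one_kronecker_one, submatrix_one_equiv]
    rw [h2, Matrix.one_mul, Matrix.one_mul] at h1
    rw [h1]

theorem aux_lim_eps {n : Type*} [Fintype n] [DecidableEq n] {A : Matrix n n ℂ}
    (hA : A.IsHermitian) (hp : ∀ i, 0 ≤ hA.eigenvalues i) (d : ℝ) :
    Tendsto (fun ε : ℝ => ∑ k, hA.eigenvalues k * Real.log (hA.eigenvalues k + d * ε))
      (𝓝[>] 0) (𝓝 (- vN A)) := by
  rw [vN, dif_pos hA, ← Finset.sum_neg_distrib]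
  apply tendsto_finsetSum
  intro k _
  rcases (hp k).eq_or_lt with h | h
  · simp [← h]
  · have h1 : Tendsto (fun ε : ℝ => hA.eigenvalues k + d * ε) (𝓝[>] 0) (𝓝 (hA.eigenvalues k)) := by
      have : Continuous (fun ε : ℝ => hA.eigenvalues k + d * ε) := by fun_prop
      have h2 := this.tendsto 0
      simp only [mul_zero, add_zero] at h2
      exact h2.mono_left nhdsWithin_le_nhds
    have := (h1.log h.ne').const_mul (hA.eigenvalues k)
    simpa [Real.negMulLog] using this

/-- Strong subadditivity. -/
theorem aux_ssa {R Q E F : Type*} [Fintype R] [Fintype Q] [Fintype E] [Fintype F]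
    [DecidableEq R] [DecidableEq Q] [DecidableEq E] [DecidableEq F] [Nonempty E]
    {σ : Matrix (R × Q × E × F) (R × Q × E × F) ℂ} (hσ : σ.PosSemidef) : 0 ≤ IREQF σ := by
  have hω := aux_ptL_psd hσ
  have hω' := aux_ptL_psd (aux_mRQF_psd hσ)
  have l1 := (aux_lim_eps hω'.1 hω'.eigenvalues_nonneg (Fintype.card E)).const_sub (- vN (mRQF σ))
  have l2 := (aux_lim_eps hω.1 hω.eigenvalues_nonneg 1).const_sub (- vN σ)
  simp only [one_mul] at l2
  have := le_of_tendsto_of_tendsto l1 l2 (by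
    filter_upwards [self_mem_nhdsWithin] with ε hε
    exact aux_ssa_eps hσ ε hε)
  rw [aux_ptL_mRQF] at this
  rw [IREQF]
  linarith

end NoRevivalAux

/-- If `I(R;E|QF)_σ = 0` (with `F` an inert extension), then no revival of the mutual
information `I(R;QF)` can occur under any unitary acting on `Q ⊗ E`. -/
theorem no_revival_of_zero_cmi {R Q E F : Type*}
    [Fintype R] [Fintype Q] [Fintype E] [Fintype F]
    [DecidableEq R] [DecidableEq Q] [DecidableEq E] [DecidableEq F]
    (σ : Matrix (R × Q × E × F) (R × Q × E × F) ℂ) (hσ : IsState σ)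
    (h0 : IREQF σ = 0)
    (V : Matrix (Q × E) (Q × E) ℂ) (hV : IsUnitaryM V) :
    MI (mRQF (liftQE V * σ * (liftQE V)ᴴ)) ≤ MI (mRQF σ) := by 
  have hE : Nonempty E := by
    by_contra hne
    rw [not_nonempty_iff] at hne
    have := hσ.2
    simp [trace] at this
  set A : Matrix (Q × E × F) (Q × E × F) ℂ := (V ⊗ₖ (1 : Matrix F F ℂ)).submatrix
    (Equiv.prodAssoc Q E F).symm (Equiv.prodAssoc Q E F).symm with hA
  have hA1 : Aᴴ * A = 1 := by
    rw [hA, conjTranspose_submatrix, submatrix_mul_equiv, conjTranspose_kronecker,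
      ← mul_kronecker_mul, hV.2, conjTranspose_one, Matrix.one_mul, one_kronecker_one,
      submatrix_one_equiv]
  have hL : (liftQE V : Matrix (R × Q × E × F) (R × Q × E × F) ℂ) = (1 : Matrix R R ℂ) ⊗ₖ A := rfl
  have hLH : (liftQE V : Matrix (R × Q × E × F) (R × Q × E × F) ℂ)ᴴ
      = (1 : Matrix R R ℂ) ⊗ₖ Aᴴ := by
    rw [hL, conjTranspose_kronecker, conjTranspose_one]
  have hU : (liftQE V : Matrix (R × Q × E × F) (R × Q × E × F) ℂ)ᴴ * liftQE V = 1 :=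
    aux_kron_unit hA1
  have hτ := hσ.1.mul_mul_conjTranspose_same (liftQE V)
  have s1 := aux_ssa hτ
  have s2 := aux_vN_conj σ (liftQE V) hσ.1.1 hU
  have s3 : vN (ptL (liftQE V * σ * (liftQE V)ᴴ)) = vN (ptL σ) := by
    rw [hLH, hL, aux_ptL_conj]
    exact aux_vN_conj _ _ (aux_ptL_psd hσ.1).1 hA1
  have s4 : ptR (liftQE V * σ * (liftQE V)ᴴ) = ptR σ := by
    rw [hLH, hL]
    exact aux_ptR_conj σ A Aᴴ hA1
  rw [IREQF] at s1 h0
  rw [MI, MI, aux_ptR_mRQF, aux_ptR_mRQF, aux_ptL_mRQF, aux_ptL_mRQF, s4]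
  linarith
end
end

section
/- In the swap example: start from Φ⁺_{RQ} ⊗ γ_E on three d-dimensional systems with H(γ_E) < log d, swap Q and E between t₀ and t₁, and swap back between t₁ and t₂. Then the reduced process is Φ⁺_{RQ} → (1_R/d) ⊗ γ_{Q'} → Φ⁺_{RQ''}, and the genuine-backflow witness holds: E_sq(R;Q'')_2 = log d > H(Q')_1 = H(γ_E). -/
open Matrix
open scoped Kronecker Classical ComplexOrder

noncomputable section

/-- Squashed entanglement: half the infimum of I(A;B|E) over all finite-dimensional
extensions `ω` on `a × (E × b)` of `ρ`. -/
noncomputable def Esq {a b : Type*} [Fintype a] [Fintype b] [DecidableEq a] [DecidableEq b]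
    (ρ : Matrix (a × b) (a × b) ℂ) : ℝ :=
  sInf {x : ℝ | ∃ (k : ℕ) (ω : Matrix (a × Fin k × b) (a × Fin k × b) ℂ),
    IsState ω ∧ mOuter ω = ρ ∧ x = CMI ω / 2}

/-- Puffed entanglement: half the supremum of I(A;B|E) over all finite-dimensional
extensions `ω` on `a × (E × b)` of `ρ`. -/
noncomputable def Epuff {a b : Type*} [Fintype a] [Fintype b] [DecidableEq a] [DecidableEq b]
    (ρ : Matrix (a × b) (a × b) ℂ) : ℝ :=
  sSup {x : ℝ | ∃ (k : ℕ) (ω : Matrix (a × Fin k × b) (a × Fin k × b) ℂ),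
    IsState ω ∧ mOuter ω = ρ ∧ x = CMI ω / 2}

/-- The `d`-dimensional maximally entangled state `|Φ⁺⟩⟨Φ⁺|`. -/
def phiD (d : ℕ) : Matrix (Fin d × Fin d) (Fin d × Fin d) ℂ :=
  Matrix.of fun p q => if p.1 = p.2 ∧ q.1 = q.2 then (d : ℂ)⁻¹ else 0

/-- The swap unitary on `Q × E` with `Q ≅ E ≅ Fin d`. -/
def swapM (d : ℕ) : Matrix (Fin d × Fin d) (Fin d × Fin d) ℂ :=
  Matrix.of fun p q => if p.1 = q.2 ∧ p.2 = q.1 then 1 else 0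

/-- The entropy is determined by any real factorization of the characteristic polynomial. -/
theorem vN_of_charpoly {n m : Type*} [Fintype n] [DecidableEq n] [Fintype m]
    {A : Matrix n n ℂ} (hA : A.IsHermitian) (v : m → ℝ)
    (h : A.charpoly = ∏ i, (Polynomial.X - Polynomial.C (v i : ℂ))) :
    vN A = ∑ i, Real.negMulLog (v i) := by
  have h1 := hA.roots_charpoly_eq_eigenvalues
  have h2 : A.charpoly.roots = Multiset.map (fun i => (v i : ℂ)) Finset.univ.val := by
    rw [h, Polynomial.roots_prod _ _ (Finset.prod_ne_zero_iff.mpr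
      fun i _ => Polynomial.X_sub_C_ne_zero _)]
    simp
  rw [h2] at h1
  have h3 := congrArg (fun s => (Multiset.map (fun z : ℂ => Real.negMulLog z.re) s).sum) h1
  simp only [Multiset.map_map] at h3
  rw [vN, dif_pos hA]
  exact h3.symm

theorem vN_submatrix {n m : Type*} [Fintype n] [DecidableEq n] [Fintype m] [DecidableEq m]
    {A : Matrix n n ℂ} (hA : A.IsHermitian) (e : m ≃ n) :
    vN (A.submatrix e e) = vN A := by
  have h : (A.submatrix e e).charpoly = A.charpoly := by
    have := Matrix.charpoly_reindex e.symm A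
    simpa using this
  rw [vN_of_charpoly (hA.submatrix e) hA.eigenvalues (h.trans hA.charpoly_eq), vN, dif_pos hA]

theorem vN_kron {n m : Type*} [Fintype n] [DecidableEq n] [Fintype m] [DecidableEq m]
    {A : Matrix n n ℂ} {B : Matrix m m ℂ} (hA : A.IsHermitian) (hB : B.IsHermitian)
    (tA : A.trace = 1) (tB : B.trace = 1) :
    vN (A ⊗ₖ B) = vN A + vN B := by
  have hAB : (A ⊗ₖ B).IsHermitian := by
    rw [Matrix.IsHermitian, Matrix.conjTranspose_kronecker, hA.eq, hB.eq]
  have hc : (A ⊗ₖ B).charpoly = ∏ i : n × m, (Polynomial.X -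
      Polynomial.C ((hA.eigenvalues i.1 * hB.eigenvalues i.2 : ℝ) : ℂ)) := by
    conv_lhs => rw [hA.spectral_theorem, hB.spectral_theorem]
    rw [Unitary.conjStarAlgAut_apply, Unitary.conjStarAlgAut_apply,
      Matrix.mul_kronecker_mul, Matrix.mul_kronecker_mul, Matrix.charpoly_mul_comm, ← mul_assoc,
      ← Matrix.mul_kronecker_mul, Matrix.diagonal_kronecker_diagonal]
    simp [Matrix.charpoly_diagonal]
  rw [vN_of_charpoly hAB _ hc, vN, dif_pos hA, vN, dif_pos hB, Fintype.sum_prod_type]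
  have sA : ∑ i, hA.eigenvalues i = 1 := by
    have := hA.trace_eq_sum_eigenvalues
    rw [tA] at this
    have h := congrArg Complex.re this
    simpa using h.symm
  have sB : ∑ i, hB.eigenvalues i = 1 := by
    have := hB.trace_eq_sum_eigenvalues
    rw [tB] at this
    have h := congrArg Complex.re this
    simpa using h.symm
  simp only [Real.negMulLog_mul, Finset.sum_add_distrib, ← Finset.sum_mul, ← Finset.mul_sum,
    sA, sB, one_mul]

theorem vN_proj {n : Type*} [Fintype n] [DecidableEq n]
    {A : Matrix n n ℂ} (hA : A.IsHermitian) (hP : A * A = A) : vN A = 0 := by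
  rw [vN, dif_pos hA]
  refine Finset.sum_eq_zero fun i _ => ?_
  have h1 := hA.mulVec_eigenvectorBasis i
  set x := (hA.eigenvectorBasis i) with hx
  set l := hA.eigenvalues i
  have h2 : A *ᵥ (A *ᵥ x.ofLp) = A *ᵥ x.ofLp := by rw [Matrix.mulVec_mulVec, hP]
  have hx0 : x.ofLp ≠ 0 := by
    have := hA.eigenvectorBasis.orthonormal.ne_zero i
    intro h
    exact this ((WithLp.ofLp_eq_zero 2).1 h)
  rw [h1, Matrix.mulVec_smul, h1, smul_smul] at h2
  have h3 : (l * l - l) • x.ofLp = 0 := by rw [sub_smul, h2, sub_self]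
  rcases smul_eq_zero.1 h3 with h | h
  · have : l = 0 ∨ l = 1 := by
      have : l * (l - 1) = 0 := by linarith
      rcases mul_eq_zero.1 this with h | h
      · exact Or.inl h
      · exact Or.inr (by linarith)
    rcases this with h | h <;> simp [h]
  · exact absurd h hx0

/-- The maximally mixed state. -/
def mixD (d : ℕ) : Matrix (Fin d) (Fin d) ℂ := Matrix.diagonal fun _ => (d : ℂ)⁻¹

theorem mixD_herm (d : ℕ) : (mixD d).IsHermitian := by
  rw [mixD, Matrix.isHermitian_diagonal_iff]
  intro i
  simp [IsSelfAdjoint]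

theorem mixD_trace (d : ℕ) (hd : 0 < d) : (mixD d).trace = 1 := by
  have : (d : ℂ) ≠ 0 := by exact_mod_cast hd.ne'
  simp [mixD, Matrix.trace_diagonal, this]

theorem mixD_vN (d : ℕ) (hd : 0 < d) : vN (mixD d) = Real.log d := by
  rw [vN_of_charpoly (mixD_herm d) (fun _ : Fin d => (d : ℝ)⁻¹)
    (by rw [mixD, Matrix.charpoly_diagonal]; simp)]
  have : (d : ℝ) ≠ 0 := by exact_mod_cast hd.ne'
  simp [Real.negMulLog, this]

theorem phiD_herm (d : ℕ) : (phiD d).IsHermitian := by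
  ext i j
  simp only [phiD, Matrix.conjTranspose_apply, Matrix.of_apply, and_comm]
  split_ifs <;> simp

theorem phiD_trace (d : ℕ) (hd : 0 < d) : (phiD d).trace = 1 := by
  have : (d : ℂ) ≠ 0 := by exact_mod_cast hd.ne'
  simp [phiD, Matrix.trace, Fintype.sum_prod_type, this]

theorem phiD_proj (d : ℕ) (hd : 0 < d) : phiD d * phiD d = phiD d := by
  have : (d : ℂ) ≠ 0 := by exact_mod_cast hd.ne'
  ext ⟨a, b⟩ ⟨a', b'⟩
  simp only [phiD, Matrix.mul_apply, Matrix.of_apply, Fintype.sum_prod_type]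
  by_cases h : a = b <;> by_cases h' : a' = b' <;> simp [h, h', this]

theorem phiD_vN (d : ℕ) (hd : 0 < d) : vN (phiD d) = 0 :=
  vN_proj (phiD_herm d) (phiD_proj d hd)

theorem phiD_posSemidef (d : ℕ) (hd : 0 < d) : (phiD d).PosSemidef := by
  have h := Matrix.posSemidef_conjTranspose_mul_self (phiD d)
  rwa [(phiD_herm d).eq, phiD_proj d hd] at h

/-- Reordering `R × E × Q` as `(R × Q) × E`. -/
def regroup (a b c : Type*) : a × b × c ≃ (a × c) × b where
  toFun x := ((x.1, x.2.2), x.2.1)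
  invFun x := (x.1.1, (x.2, x.1.2))
  left_inv _ := rfl
  right_inv _ := rfl

theorem CMI_prod (d k : ℕ) (hd : 0 < d) (σ : Matrix (Fin k) (Fin k) ℂ) (hσ : σ.IsHermitian)
    (tσ : σ.trace = 1) :
    CMI ((phiD d ⊗ₖ σ).submatrix (regroup (Fin d) (Fin k) (Fin d))
      (regroup (Fin d) (Fin k) (Fin d))) = 2 * Real.log d := by
  have hd' : (d : ℂ) ≠ 0 := by exact_mod_cast hd.ne'
  have hK : (phiD d ⊗ₖ σ).IsHermitian := by
    rw [Matrix.IsHermitian, Matrix.conjTranspose_kronecker, (phiD_herm d).eq, hσ.eq]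
  set ω := (phiD d ⊗ₖ σ).submatrix (regroup (Fin d) (Fin k) (Fin d))
      (regroup (Fin d) (Fin k) (Fin d)) with hω
  have e : ∀ i j, ω i j = phiD d (i.1, i.2.2) (j.1, j.2.2) * σ i.2.1 j.2.1 := fun i j => rfl
  have h1 : mAB ω = mixD d ⊗ₖ σ := by
    ext ⟨a, b⟩ ⟨a', b'⟩
    simp only [mAB, e, Matrix.of_apply, ← Finset.sum_mul, Matrix.kroneckerMap_apply]
    congr 1
    by_cases h : a = a'
    · subst h
      simp [phiD, mixD]
    · simp only [phiD, mixD, Matrix.of_apply, Matrix.diagonal_apply_ne _ h]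
      refine Finset.sum_eq_zero fun x _ => if_neg ?_
      rintro ⟨rfl, rfl⟩
      exact h rfl
  have h2 : ptL ω = σ ⊗ₖ mixD d := by
    ext ⟨b, a⟩ ⟨b', a'⟩
    simp only [ptL, e, Matrix.of_apply, ← Finset.sum_mul, Matrix.kroneckerMap_apply]
    rw [mul_comm]
    congr 1
    by_cases h : a = a'
    · subst h
      simp [phiD, mixD]
    · simp only [phiD, mixD, Matrix.of_apply, Matrix.diagonal_apply_ne _ h]
      refine Finset.sum_eq_zero fun x _ => if_neg ?_
      rintro ⟨rfl, rfl⟩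
      exact h rfl
  have h3 : mB ω = σ := by
    ext b b'
    simp only [mB, e, Matrix.of_apply, ← Finset.sum_mul]
    simp [phiD, hd']
  rw [CMI, h1, h2, h3, hω, vN_submatrix hK, vN_kron (phiD_herm d) hσ (phiD_trace d hd) tσ,
    vN_kron hσ (mixD_herm d) tσ (mixD_trace d hd),
    vN_kron (mixD_herm d) hσ (mixD_trace d hd) tσ, phiD_vN d hd, mixD_vN d hd]
  ring

/-- Every extension of the maximally entangled state is a product. -/
theorem ext_prod (d k : ℕ) (hd : 0 < d)
    (ω : Matrix (Fin d × Fin k × Fin d) (Fin d × Fin k × Fin d) ℂ)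
    (hω : IsState ω) (h : mOuter ω = phiD d) :
    ∃ σ : Matrix (Fin k) (Fin k) ℂ, σ.IsHermitian ∧ σ.trace = 1 ∧
      ω = (phiD d ⊗ₖ σ).submatrix (regroup (Fin d) (Fin k) (Fin d))
        (regroup (Fin d) (Fin k) (Fin d)) := by
  obtain ⟨hp, ht⟩ := hω
  have hd' : (d : ℂ) ≠ 0 := by exact_mod_cast hd.ne'
  have hent : ∀ i j i' j', ∑ e, ω (i, e, j) (i', e, j') = phiD d (i, j) (i', j') := by
    intro i j i' j'
    rw [← h]; rfl
  -- a family of vectors with zero total expectation lies in the kernel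
  have key : ∀ v : Fin k → (Fin d × Fin k × Fin d → ℂ),
      ∑ e, (star (v e) ⬝ᵥ (ω *ᵥ v e)) = 0 → ∀ e, ω *ᵥ v e = 0 := by
    intro v hv e
    have := (Finset.sum_eq_zero_iff_of_nonneg
      (fun e _ => hp.dotProduct_mulVec_nonneg (v e))).1 hv e (Finset.mem_univ e)
    exact (hp.dotProduct_mulVec_zero_iff _).1 this
  have hoff : ∀ i j, i ≠ j → ∀ x e, ω x (i, e, j) = 0 := by
    intro i j hij x e
    have := key (fun e => Pi.single (i, e, j) 1) (by
      simp only [Matrix.mulVec_single_one, ← Pi.single_star, star_one, single_one_dotProduct]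
      exact (hent i j i j).trans (by simp [phiD, hij])) e
    rw [Matrix.mulVec_single_one] at this
    exact congrFun this x
  have hon : ∀ i j, ∀ x e, ω x (i, e, i) = ω x (j, e, j) := by
    intro i j x e
    have := key (fun e => Pi.single (i, e, i) 1 - Pi.single (j, e, j) 1) (by
      simp only [Matrix.mulVec_sub, star_sub, Matrix.mulVec_single_one, ← Pi.single_star,
        star_one, sub_dotProduct, dotProduct_sub, single_one_dotProduct, Finset.sum_sub_distrib]
      have := hent i i i i
      have h2 := hent i i j j
      have h3 := hent j j i i
      have h4 := hent j j j j
      simp only [phiD, Matrix.of_apply, and_self, if_true] at this h2 h3 h4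
      simp only [Matrix.col_apply]
      rw [this, h2, h3, h4]
      ring) e
    rw [Matrix.mulVec_sub, Matrix.mulVec_single_one, Matrix.mulVec_single_one, sub_eq_zero] at this
    exact congrFun this x
  have hH : ∀ x y, ω x y = star (ω y x) := fun x y => (hp.1.apply x y).symm
  let z : Fin d := ⟨0, hd⟩
  have hform : ω = (phiD d ⊗ₖ (Matrix.of fun e e' => (d : ℂ) * ω (z, e, z) (z, e', z))).submatrix
      (regroup (Fin d) (Fin k) (Fin d)) (regroup (Fin d) (Fin k) (Fin d)) := by
    ext ⟨a, e, b⟩ ⟨a', e', b'⟩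
    simp only [Matrix.submatrix_apply, regroup, Equiv.coe_fn_mk, Matrix.kroneckerMap_apply, phiD,
      Matrix.of_apply]
    by_cases h1 : a = b
    · by_cases h2 : a' = b'
      · subst h1 h2
        rw [hon a' z, hH, hon a z, ← hH]
        simp [hd']
      · rw [hoff a' b' h2]; simp [h2]
    · rw [hH, hoff a b h1]; simp [h1]
  refine ⟨Matrix.of fun e e' => (d : ℂ) * ω (z, e, z) (z, e', z), ?_, ?_, hform⟩
  · ext e e'
    simp only [Matrix.conjTranspose_apply, Matrix.of_apply, star_mul']
    rw [← hH]; simp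
  · have := hent z z z z
    simp only [phiD, Matrix.of_apply, and_self, if_true] at this
    simp only [Matrix.trace, Matrix.diag_apply, Matrix.of_apply, ← Finset.mul_sum, this]
    exact mul_inv_cancel₀ hd'

theorem Esq_phiD (d : ℕ) (hd : 0 < d) : Esq (phiD d) = Real.log d := by
  have : {x : ℝ | ∃ (k : ℕ) (ω : Matrix (Fin d × Fin k × Fin d) (Fin d × Fin k × Fin d) ℂ),
      IsState ω ∧ mOuter ω = phiD d ∧ x = CMI ω / 2} = {Real.log d} := by
    ext x
    simp only [Set.mem_ofPred_eq, Set.mem_singleton_iff]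
    constructor
    · rintro ⟨k, ω, hs, ho, rfl⟩
      obtain ⟨σ, h1, h2, rfl⟩ := ext_prod d k hd ω hs ho
      rw [CMI_prod d k hd σ h1 h2]
      ring
    · rintro rfl
      refine ⟨1, (phiD d ⊗ₖ (1 : Matrix (Fin 1) (Fin 1) ℂ)).submatrix
        (regroup (Fin d) (Fin 1) (Fin d)) (regroup (Fin d) (Fin 1) (Fin d)), ⟨?_, ?_⟩, ?_, ?_⟩
      · exact ((phiD_posSemidef d hd).kronecker Matrix.PosSemidef.one).submatrix _
      · have h1 : (phiD d ⊗ₖ (1 : Matrix (Fin 1) (Fin 1) ℂ)).trace = 1 := by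
          rw [Matrix.trace_kronecker, phiD_trace d hd]; simp
        rw [← h1]
        exact Equiv.sum_comp (regroup (Fin d) (Fin 1) (Fin d))
          (fun i => (phiD d ⊗ₖ (1 : Matrix (Fin 1) (Fin 1) ℂ)) i i)
      · ext i j
        simp [mOuter, regroup]
      · rw [CMI_prod d 1 hd 1 Matrix.isHermitian_one (by simp)]
        ring
  rw [Esq, this, csInf_singleton]

/-- Conjugation with `1 ⊗ SWAP` permutes the indices. -/
theorem swap_conj (d : ℕ) (M : Matrix (Fin d × Fin d × Fin d) (Fin d × Fin d × Fin d) ℂ) :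
    ((1 : Matrix (Fin d) (Fin d) ℂ) ⊗ₖ swapM d) * M
      * ((1 : Matrix (Fin d) (Fin d) ℂ) ⊗ₖ swapM d)ᴴ
    = M.submatrix (fun i => (i.1, i.2.2, i.2.1)) (fun i => (i.1, i.2.2, i.2.1)) := by
  have h : ((1 : Matrix (Fin d) (Fin d) ℂ) ⊗ₖ swapM d)
      = (1 : Matrix (Fin d × Fin d × Fin d) (Fin d × Fin d × Fin d) ℂ).submatrix
        (fun i => (i.1, i.2.2, i.2.1)) (Equiv.refl _) := by
    ext ⟨a, b, c⟩ ⟨a', b', c'⟩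
    simp only [Matrix.kroneckerMap_apply, Matrix.one_apply, swapM, Matrix.of_apply,
      Matrix.submatrix_apply, Equiv.refl_apply, Prod.mk.injEq]
    by_cases h1 : a = a' <;> by_cases h2 : b = c' <;> by_cases h3 : c = b' <;> simp [h1, h2, h3]
  rw [h, Matrix.conjTranspose_submatrix, Matrix.conjTranspose_one, Matrix.one_submatrix_mul,
    Matrix.mul_submatrix_one]
  rfl

/-- The swap example: start from `Φ⁺_{RQ} ⊗ γ_E` with `H(γ_E) < log d`, swap `Q` and
`E`, and swap back. The reduced process is `Φ⁺ → (𝟙/d) ⊗ γ → Φ⁺`, and the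
genuine-backflow witness `E_sq(R;Q'')₂ = log d > H(Q')₁ = H(γ)` holds. -/
theorem swap_example_genuine_backflow (d : ℕ) (hd : 0 < d)
    (γ : Matrix (Fin d) (Fin d) ℂ) (hγ : IsState γ) (hH : vN γ < Real.log d) :
    mAB (((1 : Matrix (Fin d) (Fin d) ℂ) ⊗ₖ swapM d)
          * (Matrix.of fun (i j : Fin d × Fin d × Fin d) =>
              phiD d (i.1, i.2.1) (j.1, j.2.1) * γ i.2.2 j.2.2)
          * ((1 : Matrix (Fin d) (Fin d) ℂ) ⊗ₖ swapM d)ᴴ)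
        = Matrix.of (fun (i j : Fin d × Fin d) =>
            (if i.1 = j.1 then (d : ℂ)⁻¹ else 0) * γ i.2 j.2)
    ∧ mAB (((1 : Matrix (Fin d) (Fin d) ℂ) ⊗ₖ swapM d)
          * (((1 : Matrix (Fin d) (Fin d) ℂ) ⊗ₖ swapM d)
              * (Matrix.of fun (i j : Fin d × Fin d × Fin d) =>
                  phiD d (i.1, i.2.1) (j.1, j.2.1) * γ i.2.2 j.2.2)
              * ((1 : Matrix (Fin d) (Fin d) ℂ) ⊗ₖ swapM d)ᴴ)
          * ((1 : Matrix (Fin d) (Fin d) ℂ) ⊗ₖ swapM d)ᴴ)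
        = phiD d
    ∧ Esq (phiD d) = Real.log d
    ∧ vN (ptL (Matrix.of (fun (i j : Fin d × Fin d) =>
          (if i.1 = j.1 then (d : ℂ)⁻¹ else 0) * γ i.2 j.2))) = vN γ
    ∧ vN (ptL (Matrix.of (fun (i j : Fin d × Fin d) =>
          (if i.1 = j.1 then (d : ℂ)⁻¹ else 0) * γ i.2 j.2))) < Esq (phiD d) := by
  have hd' : (d : ℂ) ≠ 0 := by exact_mod_cast hd.ne'
  have hpt : ptL (Matrix.of (fun (i j : Fin d × Fin d) =>
          (if i.1 = j.1 then (d : ℂ)⁻¹ else 0) * γ i.2 j.2)) = γ := by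
    ext i j
    simp [ptL, hd']
  refine ⟨?_, ?_, Esq_phiD d hd, ?_, ?_⟩
  · rw [swap_conj]
    ext ⟨a, b⟩ ⟨a', b'⟩
    simp only [mAB, Matrix.of_apply, Matrix.submatrix_apply, ← Finset.sum_mul]
    congr 1
    by_cases h : a = a'
    · subst h
      simp [phiD]
    · rw [if_neg h]
      refine Finset.sum_eq_zero fun x _ => if_neg ?_
      rintro ⟨h1, h2⟩
      exact h (h1.trans h2.symm)
  · rw [swap_conj, swap_conj]
    ext ⟨a, b⟩ ⟨a', b'⟩
    have ht : ∑ k, γ k k = 1 := hγ.2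
    simp only [mAB, Matrix.of_apply, Matrix.submatrix_apply, ← Finset.mul_sum, ht, mul_one]
  · rw [hpt]
  · rw [hpt, Esq_phiD d hd]
    exact hH
end
end

section
/- Strong subadditivity in mutual-information form: for any tripartite density matrix ρ_{ABC} on finite-dimensional Hilbert spaces, I(A;BC)_ρ ≥ I(A;B)_ρ, i.e., quantum mutual information is monotone under partial trace (data-processing for partial trace). -/
open Matrix
open scoped Kronecker Classical ComplexOrder

noncomputable section

theorem ssa_vN_eq {n : Type*} [Fintype n] [DecidableEq n] {ρ U : Matrix n n ℂ} {p : n → ℝ}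
    (h1 : U * Uᴴ = 1) (h2 : Uᴴ * U = 1)
    (hρ : ρ = U * diagonal (fun i => (p i : ℂ)) * Uᴴ) :
    vN ρ = ∑ i, Real.negMulLog (p i) := by
  have hH : ρ.IsHermitian := by
    rw [hρ]
    apply Matrix.isHermitian_mul_mul_conjTranspose
    rw [Matrix.IsHermitian, diagonal_conjTranspose]
    congr 1; ext i; simp
  rw [vN, dif_pos hH]
  have e1 := hH.roots_charpoly_eq_eigenvalues
  have e2 : ρ.charpoly = (diagonal (fun i => (p i : ℂ))).charpoly := by
    rw [hρ, Matrix.mul_assoc, Matrix.charpoly_mul_comm, Matrix.mul_assoc, h2, Matrix.mul_one]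
  rw [e2, Matrix.charpoly_diagonal, Polynomial.roots_prod _ _ (Finset.prod_ne_zero_iff.2
    fun i _ => Polynomial.X_sub_C_ne_zero _)] at e1
  simp only [Polynomial.roots_X_sub_C, Multiset.bind_singleton] at e1
  have e3 := congrArg (fun s => (s.map (fun z : ℂ => Real.negMulLog z.re)).sum) e1
  simp only [Multiset.map_map] at e3
  simpa [Function.comp_def] using e3.symm

theorem ssa_spec {n : Type*} [Fintype n] [DecidableEq n] {ρ : Matrix n n ℂ}
    (hρ : ρ.PosSemidef) : ∃ (U : Matrix n n ℂ) (p : n → ℝ), U * Uᴴ = 1 ∧ Uᴴ * U = 1 ∧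
      (∀ i, 0 ≤ p i) ∧ ρ = U * diagonal (fun i => (p i : ℂ)) * Uᴴ := by
  refine ⟨hρ.1.eigenvectorUnitary, hρ.1.eigenvalues, ?_, ?_, hρ.eigenvalues_nonneg, ?_⟩
  · exact Unitary.mul_star_self_of_mem hρ.1.eigenvectorUnitary.2
  · exact Unitary.star_mul_self_of_mem hρ.1.eigenvectorUnitary.2
  · have := hρ.1.spectral_theorem
    rw [Unitary.conjStarAlgAut_apply] at this
    exact this

theorem ssa_shift {n : Type*} [Fintype n] [DecidableEq n] {ρ U : Matrix n n ℂ} {p : n → ℝ}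
    (h1 : U * Uᴴ = 1) (hρ : ρ = U * diagonal (fun i => (p i : ℂ)) * Uᴴ) (e : ℝ) :
    ρ + (e : ℂ) • (1 : Matrix n n ℂ) = U * diagonal (fun i => ((p i + e : ℝ) : ℂ)) * Uᴴ := by
  have : diagonal (fun i => ((p i + e : ℝ) : ℂ)) =
      diagonal (fun i => (p i : ℂ)) + (e : ℂ) • (1 : Matrix n n ℂ) := by
    ext i j
    by_cases h : i = j
    · subst h; simp
    · simp [h]
  rw [this, Matrix.mul_add, Matrix.add_mul, ← hρ]
  simp [h1]

/-- the quadratic functional -/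
def ssaJ {n : Type*} [Fintype n] (t : ℝ) (ρ σ X : Matrix n n ℂ) : ℝ :=
  2 * (X * ρ).trace.re - (X * Xᴴ * σ).trace.re - t * (Xᴴ * X * ρ).trace.re

theorem ssaJ_eq {n : Type*} [Fintype n] [DecidableEq n] {ρ U σ V : Matrix n n ℂ} {p q : n → ℝ}
    (h2 : Uᴴ * U = 1) (h4 : Vᴴ * V = 1)
    (hρ : ρ = U * diagonal (fun i => (p i : ℂ)) * Uᴴ)
    (hσ : σ = V * diagonal (fun i => (q i : ℂ)) * Vᴴ) (t : ℝ) (Y : Matrix n n ℂ) :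
    ssaJ t ρ σ (V * Y * Uᴴ) = ∑ i, ∑ j, (2 * p i * (Y j i * (Uᴴ * V) i j).re
      - (q j + t * p i) * Complex.normSq (Y j i)) := by
  have a1 : (V * Y * Uᴴ * ρ).trace = (Y * diagonal (fun i => (p i : ℂ)) * (Uᴴ * V)).trace := by
    rw [hρ]
    calc _ = (V * (Y * (Uᴴ * U) * diagonal (fun i => (p i : ℂ)) * Uᴴ)).trace := by
          simp only [Matrix.mul_assoc]
      _ = _ := by rw [h2, Matrix.trace_mul_comm]; simp only [Matrix.mul_assoc, Matrix.mul_one, Matrix.one_mul]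
  have a2 : (V * Y * Uᴴ * (V * Y * Uᴴ)ᴴ * σ).trace
      = (Y * Yᴴ * diagonal (fun i => (q i : ℂ))).trace := by
    rw [hσ]
    calc _ = (V * (Y * (Uᴴ * U) * Yᴴ * (Vᴴ * V) * diagonal (fun i => (q i : ℂ)) * Vᴴ)).trace := by
          simp only [Matrix.mul_assoc, Matrix.conjTranspose_mul, Matrix.conjTranspose_conjTranspose]
      _ = _ := by
          rw [h2, h4, Matrix.trace_mul_comm, Matrix.mul_assoc _ Vᴴ V, h4]
          simp only [Matrix.mul_assoc, Matrix.mul_one, Matrix.one_mul]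
  have a3 : ((V * Y * Uᴴ)ᴴ * (V * Y * Uᴴ) * ρ).trace
      = (Yᴴ * Y * diagonal (fun i => (p i : ℂ))).trace := by
    rw [hρ]
    calc _ = (U * (Yᴴ * (Vᴴ * V) * Y * (Uᴴ * U) * diagonal (fun i => (p i : ℂ)) * Uᴴ)).trace := by
          simp only [Matrix.mul_assoc, Matrix.conjTranspose_mul, Matrix.conjTranspose_conjTranspose]
      _ = _ := by
          rw [h2, h4, Matrix.trace_mul_comm, Matrix.mul_assoc _ Uᴴ U, h2]
          simp only [Matrix.mul_assoc, Matrix.mul_one, Matrix.one_mul]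
  have b1 : (Y * diagonal (fun i => (p i : ℂ)) * (Uᴴ * V)).trace.re =
      ∑ i, ∑ j, p i * (Y j i * (Uᴴ * V) i j).re := by
    generalize Uᴴ * V = W
    rw [Finset.sum_comm]
    simp only [Matrix.trace, Matrix.diag_apply, Matrix.mul_apply (M := Y * _),
      Matrix.mul_diagonal, Complex.re_sum]
    refine Finset.sum_congr rfl fun j _ => Finset.sum_congr rfl fun i _ => ?_
    simp; ring
  have b2 : (Y * Yᴴ * diagonal (fun i => (q i : ℂ))).trace.re =
      ∑ i, ∑ j, q j * Complex.normSq (Y j i) := by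
    rw [Finset.sum_comm]
    simp only [Matrix.trace, Matrix.diag_apply, Matrix.mul_diagonal, Complex.re_sum,
      Matrix.mul_apply (M := Y), Finset.sum_mul, Matrix.conjTranspose_apply]
    refine Finset.sum_congr rfl fun j _ => Finset.sum_congr rfl fun i _ => ?_
    simp [Complex.normSq_apply]; ring
  have b3 : (Yᴴ * Y * diagonal (fun i => (p i : ℂ))).trace.re =
      ∑ i, ∑ j, p i * Complex.normSq (Y j i) := by
    simp only [Matrix.trace, Matrix.diag_apply, Matrix.mul_diagonal, Complex.re_sum,
      Matrix.mul_apply (M := Yᴴ), Finset.sum_mul, Matrix.conjTranspose_apply]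
    refine Finset.sum_congr rfl fun j _ => Finset.sum_congr rfl fun i _ => ?_
    simp [Complex.normSq_apply]; ring
  rw [ssaJ, a1, a2, a3, b1, b2, b3]
  simp only [Finset.mul_sum, ← Finset.sum_sub_distrib]
  refine Finset.sum_congr rfl fun j _ => Finset.sum_congr rfl fun i _ => ?_
  ring

/-- the value of the supremum -/
def ssaPhi {n : Type*} [Fintype n] (c : n → n → ℝ) (p q : n → ℝ) (t : ℝ) : ℝ :=
  ∑ i, ∑ j, c i j * (p i ^ 2 / (q j + t * p i))

theorem ssaJ_le {n : Type*} [Fintype n] [DecidableEq n] {ρ U σ V : Matrix n n ℂ} {p q : n → ℝ}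
    (h1 : U * Uᴴ = 1) (h2 : Uᴴ * U = 1) (h3 : V * Vᴴ = 1) (h4 : Vᴴ * V = 1)
    (hp : ∀ i, 0 < p i) (hq : ∀ i, 0 < q i)
    (hρ : ρ = U * diagonal (fun i => (p i : ℂ)) * Uᴴ)
    (hσ : σ = V * diagonal (fun i => (q i : ℂ)) * Vᴴ) {t : ℝ} (ht : 0 ≤ t) (X : Matrix n n ℂ) :
    ssaJ t ρ σ X ≤ ssaPhi (fun i j => Complex.normSq ((Uᴴ * V) i j)) p q t := by
  have hX : X = V * (Vᴴ * X * U) * Uᴴ := by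
    calc X = (V * Vᴴ) * X * (U * Uᴴ) := by rw [h1, h3, Matrix.mul_one, Matrix.one_mul]
      _ = _ := by simp only [Matrix.mul_assoc]
  rw [hX, ssaJ_eq h2 h4 hρ hσ, ssaPhi]
  refine Finset.sum_le_sum fun i _ => Finset.sum_le_sum fun j _ => ?_
  generalize (Vᴴ * X * U) j i = y
  generalize (Uᴴ * V) i j = w
  have hs : 0 < q j + t * p i := by have := hp i; have := hq j; positivity
  generalize q j + t * p i = s at *
  generalize p i = r
  simp only [Complex.normSq_apply, Complex.mul_re]
  rw [← mul_div_assoc, le_div_iff₀ hs]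
  nlinarith [sq_nonneg (s * y.re - r * w.re), sq_nonneg (s * y.im + r * w.im)]

theorem ssaJ_attain {n : Type*} [Fintype n] [DecidableEq n] {ρ U σ V : Matrix n n ℂ}
    {p q : n → ℝ} (h2 : Uᴴ * U = 1) (h4 : Vᴴ * V = 1)
    (hp : ∀ i, 0 < p i) (hq : ∀ i, 0 < q i)
    (hρ : ρ = U * diagonal (fun i => (p i : ℂ)) * Uᴴ)
    (hσ : σ = V * diagonal (fun i => (q i : ℂ)) * Vᴴ) {t : ℝ} (ht : 0 ≤ t) :
    ∃ X, ssaJ t ρ σ X = ssaPhi (fun i j => Complex.normSq ((Uᴴ * V) i j)) p q t := by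
  refine ⟨V * (Matrix.of fun j i => ((p i / (q j + t * p i) : ℝ) : ℂ) *
    (starRingEnd ℂ) ((Uᴴ * V) i j)) * Uᴴ, ?_⟩
  rw [ssaJ_eq h2 h4 hρ hσ, ssaPhi]
  refine Finset.sum_congr rfl fun i _ => Finset.sum_congr rfl fun j _ => ?_
  rw [Matrix.of_apply]
  generalize (Uᴴ * V) i j = w
  have hs : 0 < q j + t * p i := by have := hp i; have := hq j; positivity
  generalize q j + t * p i = s at *
  generalize p i = r
  rw [mul_assoc ((r / s : ℝ) : ℂ), mul_comm _ w, Complex.mul_conj, ← Complex.ofReal_mul, Complex.ofReal_re,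
    Complex.normSq_mul, Complex.normSq_ofReal, Complex.normSq_conj]
  field_simp
  ring

/-- relative entropy in coordinates -/
def ssaD {n : Type*} [Fintype n] (c : n → n → ℝ) (p q : n → ℝ) : ℝ :=
  ∑ i, ∑ j, c i j * (p i * (Real.log (p i) - Real.log (q j)))

/-- truncated relative entropy in coordinates -/
def ssaDT {n : Type*} [Fintype n] (c : n → n → ℝ) (p q : n → ℝ) (T : ℝ) : ℝ :=
  ∑ i, ∑ j, c i j * (p i * (Real.log (q j + T * p i) - Real.log (q j)))

theorem ssaDT_deriv {n : Type*} [Fintype n] (c : n → n → ℝ) (p q : n → ℝ)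
    (hp : ∀ i, 0 < p i) (hq : ∀ i, 0 < q i) {T : ℝ} (hT : 0 ≤ T) :
    HasDerivAt (ssaDT c p q) (ssaPhi c p q T) T := by
  unfold ssaDT ssaPhi
  refine HasDerivAt.fun_sum fun i _ => HasDerivAt.fun_sum fun j _ => ?_
  refine HasDerivAt.const_mul _ ?_
  have hs : 0 < q j + T * p i := by have := hp i; have := hq j; positivity
  have h0 : HasDerivAt (fun T => q j + T * p i) (p i) T := by
    simpa using ((hasDerivAt_id T).mul_const (p i)).const_add (q j)
  have h := (((h0.log hs.ne').sub_const (Real.log (q j))).const_mul (p i))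
  convert h using 1
  field_simp

theorem ssaDT_tendsto {n : Type*} [Fintype n] (c : n → n → ℝ) (p q : n → ℝ)
    (hp : ∀ i, 0 < p i) (hq : ∀ i, 0 < q i) :
    Filter.Tendsto (fun T => ssaDT c p q T - (∑ i, ∑ j, c i j * p i) * Real.log T) Filter.atTop
      (nhds (ssaD c p q)) := by
  have h : Filter.Tendsto (fun T : ℝ => ∑ i, ∑ j, c i j * (p i * (Real.log (q j * T⁻¹ + p i)
      - Real.log (q j)))) Filter.atTop (nhds (ssaD c p q)) := by
    unfold ssaD
    refine tendsto_finsetSum _ fun i _ => tendsto_finsetSum _ fun j _ => ?_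
    refine Filter.Tendsto.const_mul _ (Filter.Tendsto.const_mul _ ?_)
    refine Filter.Tendsto.sub_const ?_ _
    refine Filter.Tendsto.log ?_ (hp i).ne'
    simpa using (tendsto_inv_atTop_zero.const_mul (q j)).add_const (p i)
  refine h.congr' ?_
  filter_upwards [Filter.eventually_gt_atTop 0] with T hT
  unfold ssaDT
  simp only [Finset.sum_mul, ← Finset.sum_sub_distrib]
  refine Finset.sum_congr rfl fun i _ => Finset.sum_congr rfl fun j _ => ?_
  have hs : 0 < q j + T * p i := by have := hp i; have := hq j; positivity
  have : q j * T⁻¹ + p i = (q j + T * p i) / T := by field_simp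
  rw [this, Real.log_div hs.ne' hT.ne']
  ring

theorem ssaD_mono {n m : Type*} [Fintype n] [Fintype m] (c : n → n → ℝ) (p q : n → ℝ)
    (hp : ∀ i, 0 < p i) (hq : ∀ i, 0 < q i) (c' : m → m → ℝ) (p' q' : m → ℝ)
    (hp' : ∀ i, 0 < p' i) (hq' : ∀ i, 0 < q' i)
    (hphi : ∀ t, 0 ≤ t → ssaPhi c' p' q' t ≤ ssaPhi c p q t)
    (htr : ∑ i, ∑ j, c' i j * p' i = ∑ i, ∑ j, c i j * p i) :
    ssaD c' p' q' ≤ ssaD c p q := by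
  have hm : MonotoneOn (fun T => ssaDT c p q T - ssaDT c' p' q' T) (Set.Ici 0) := by
    have hd : ∀ T : ℝ, 0 ≤ T → HasDerivAt (fun T => ssaDT c p q T - ssaDT c' p' q' T)
        (ssaPhi c p q T - ssaPhi c' p' q' T) T := fun T hT =>
      (ssaDT_deriv c p q hp hq hT).sub (ssaDT_deriv c' p' q' hp' hq' hT)
    refine monotoneOn_of_deriv_nonneg (convex_Ici 0)
      (fun T hT => (hd T hT).continuousAt.continuousWithinAt)
      (fun T hT => (hd T (interior_subset hT)).differentiableAt.differentiableWithinAt) ?_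
    intro T hT
    have hT : 0 ≤ T := interior_subset (s := Set.Ici (0:ℝ)) hT
    rw [(hd T hT).deriv]
    linarith [hphi T hT]
  refine le_of_tendsto_of_tendsto (ssaDT_tendsto c' p' q' hp' hq') (ssaDT_tendsto c p q hp hq) ?_
  filter_upwards [Filter.eventually_ge_atTop 0] with T hT
  have := hm (Set.mem_Ici.2 le_rfl) hT hT
  simp [ssaDT] at this
  rw [htr]
  simp only [ssaDT]
  linarith

theorem ssa_row {n : Type*} [Fintype n] [DecidableEq n] {W : Matrix n n ℂ}
    (h : W * Wᴴ = 1) (i : n) : ∑ j, Complex.normSq (W i j) = 1 := by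
  have := congrFun (congrFun h i) i
  rw [Matrix.mul_apply, Matrix.one_apply_eq] at this
  have := congrArg Complex.re this
  rw [Complex.re_sum] at this
  simpa [Complex.normSq_apply] using this

theorem ssa_diag {n : Type*} [Fintype n] [DecidableEq n] {ρ U V : Matrix n n ℂ} {p : n → ℝ}
    (hρ : ρ = U * diagonal (fun i => (p i : ℂ)) * Uᴴ) (j : n) :
    ∑ i, Complex.normSq ((Uᴴ * V) i j) * p i = ((Vᴴ * ρ * V) j j).re := by
  have : Vᴴ * ρ * V = (Uᴴ * V)ᴴ * diagonal (fun i => (p i : ℂ)) * (Uᴴ * V) := by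
    rw [hρ]; simp only [Matrix.mul_assoc, Matrix.conjTranspose_mul, Matrix.conjTranspose_conjTranspose]
  rw [this]
  generalize Uᴴ * V = W
  rw [Matrix.mul_apply, Complex.re_sum]
  refine Finset.sum_congr rfl fun i _ => ?_
  simp [Complex.normSq_apply]; ring

theorem ssa_entropy {a m : Type*} [Fintype a] [Fintype m] [DecidableEq a] [DecidableEq m]
    {ρ U : Matrix (a × m) (a × m) ℂ} {p : a × m → ℝ} {V : Matrix m m ℂ} {q : m → ℝ}
    (h2 : Uᴴ * U = 1) (h3 : V * Vᴴ = 1) (h4 : Vᴴ * V = 1)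
    (hρ : ρ = U * diagonal (fun i => (p i : ℂ)) * Uᴴ)
    (hσ : ptL ρ = V * diagonal (fun i => (q i : ℂ)) * Vᴴ) :
    ssaD (fun i j => Complex.normSq ((Uᴴ * ((1 : Matrix a a ℂ) ⊗ₖ V)) i j)) p (fun j => q j.2)
      = - (∑ i, Real.negMulLog (p i)) + ∑ j, Real.negMulLog (q j) := by
  have hW : (Uᴴ * ((1 : Matrix a a ℂ) ⊗ₖ V)) * (Uᴴ * ((1 : Matrix a a ℂ) ⊗ₖ V))ᴴ = 1 := by
    calc _ = Uᴴ * (((1 : Matrix a a ℂ) ⊗ₖ V) * ((1 : Matrix a a ℂ) ⊗ₖ V)ᴴ) * U := by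
          simp only [Matrix.mul_assoc, Matrix.conjTranspose_mul, Matrix.conjTranspose_conjTranspose]
      _ = 1 := by
          rw [Matrix.conjTranspose_kronecker, ← Matrix.mul_kronecker_mul, h3]
          simp [h2]
  have e1 : ∑ i, ∑ j, Complex.normSq ((Uᴴ * ((1 : Matrix a a ℂ) ⊗ₖ V)) i j) *
      (p i * Real.log (p i)) = - (∑ i, Real.negMulLog (p i)) := by
    simp only [← Finset.sum_mul, ssa_row hW, Real.negMulLog]
    rw [← Finset.sum_neg_distrib]
    exact Finset.sum_congr rfl fun i _ => by ring
  have e2 : ∑ i, ∑ j, Complex.normSq ((Uᴴ * ((1 : Matrix a a ℂ) ⊗ₖ V)) i j) *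
      (p i * Real.log (q j.2)) = - ∑ j, Real.negMulLog (q j) := by
    rw [Finset.sum_comm]
    simp only [← mul_assoc, ← Finset.sum_mul, ssa_diag hρ]
    rw [Fintype.sum_prod_type, Finset.sum_comm, ← Finset.sum_neg_distrib]
    refine Finset.sum_congr rfl fun j _ => ?_
    dsimp only
    rw [← Finset.sum_mul, Real.negMulLog]
    have key : ∑ x : a, ((((1 : Matrix a a ℂ) ⊗ₖ V)ᴴ * ρ * ((1 : Matrix a a ℂ) ⊗ₖ V))
        (x, j) (x, j)) = (Vᴴ * ptL ρ * V) j j := by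
      simp only [Matrix.mul_apply, Fintype.sum_prod_type, Matrix.conjTranspose_apply,
        Matrix.kroneckerMap_apply, ptL, Matrix.of_apply, Matrix.one_apply]
      simp only [ite_mul, one_mul, zero_mul, apply_ite star, star_zero, mul_ite, mul_zero,
        Finset.sum_ite_irrel, Finset.sum_const_zero, Finset.sum_ite_eq', Finset.sum_ite_eq,
        Finset.mem_univ, if_true]
      rw [Finset.sum_comm]
      refine Finset.sum_congr rfl fun k _ => ?_
      rw [← Finset.sum_mul, Finset.sum_comm]
      simp only [Finset.mul_sum]
    have hv : Vᴴ * ptL ρ * V = diagonal (fun i => (q i : ℂ)) := by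
      rw [hσ]
      calc _ = (Vᴴ * V) * diagonal (fun i => (q i : ℂ)) * (Vᴴ * V) := by
            simp only [Matrix.mul_assoc]
        _ = _ := by rw [h4, Matrix.one_mul, Matrix.mul_one]
    rw [hv, Matrix.diagonal_apply_eq] at key
    have := congrArg Complex.re key
    rw [Complex.re_sum, Complex.ofReal_re] at this
    rw [this]; ring
  have : ∑ j, Real.negMulLog (q j) = -(- ∑ j, Real.negMulLog (q j)) := by ring
  rw [this, ← e1, ← e2, ssaD, ← sub_eq_add_neg, ← Finset.sum_sub_distrib]
  simp only [← Finset.sum_sub_distrib]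
  refine Finset.sum_congr rfl fun i _ => Finset.sum_congr rfl fun j _ => ?_
  ring

theorem ssa_csum {n : Type*} [Fintype n] [DecidableEq n] {ρ U V : Matrix n n ℂ} {p : n → ℝ}
    (h3 : V * Vᴴ = 1)
    (hρ : ρ = U * diagonal (fun i => (p i : ℂ)) * Uᴴ) :
    ∑ i, ∑ j, Complex.normSq ((Uᴴ * V) i j) * p i = ρ.trace.re := by
  rw [Finset.sum_comm]
  simp only [ssa_diag hρ, ← Complex.re_sum]
  congr 1
  change (Vᴴ * ρ * V).trace = _
  rw [Matrix.trace_mul_comm, ← Matrix.mul_assoc, h3, Matrix.one_mul]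

/-- ampliation `X ↦ X ⊗ 1_C` -/
def ssaE {A B C : Type*} [DecidableEq C] (X : Matrix (A × B) (A × B) ℂ) :
    Matrix (A × B × C) (A × B × C) ℂ :=
  (X ⊗ₖ (1 : Matrix C C ℂ)).submatrix (Equiv.prodAssoc A B C).symm (Equiv.prodAssoc A B C).symm

theorem ssaE_mul {A B C : Type*} [Fintype A] [Fintype B] [Fintype C] [DecidableEq C]
    (X Y : Matrix (A × B) (A × B) ℂ) :
    (ssaE (X * Y) : Matrix (A × B × C) (A × B × C) ℂ) = ssaE X * ssaE Y := by
  simp only [ssaE]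
  rw [Matrix.submatrix_mul_equiv, ← Matrix.mul_kronecker_mul, Matrix.one_mul]

theorem ssaE_conj {A B C : Type*} [DecidableEq C] (X : Matrix (A × B) (A × B) ℂ) :
    (ssaE (Xᴴ) : Matrix (A × B × C) (A × B × C) ℂ) = (ssaE X)ᴴ := by
  simp only [ssaE]
  rw [Matrix.conjTranspose_submatrix, Matrix.conjTranspose_kronecker, Matrix.conjTranspose_one]

theorem ssaE_trace {A B C : Type*} [Fintype A] [Fintype B] [Fintype C] [DecidableEq C]
    (X : Matrix (A × B) (A × B) ℂ) (ρ : Matrix (A × B × C) (A × B × C) ℂ) :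
    (ssaE X * ρ).trace = (X * mAB ρ).trace := by
  simp only [ssaE, mAB, Matrix.trace, Matrix.diag_apply, Matrix.mul_apply, Matrix.submatrix_apply,
    Fintype.sum_prod_type, Matrix.kroneckerMap_apply, Matrix.of_apply, Matrix.one_apply,
    Equiv.prodAssoc_symm_apply]
  simp only [mul_ite, mul_one, mul_zero, ite_mul, zero_mul, Finset.sum_ite_eq, Finset.mem_univ,
    if_true, Finset.mul_sum]
  refine Finset.sum_congr rfl fun a _ => Finset.sum_congr rfl fun b _ => ?_
  rw [Finset.sum_comm]
  refine Finset.sum_congr rfl fun a' _ => ?_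
  rw [Finset.sum_comm]

theorem ssaE_J {A B C : Type*} [Fintype A] [Fintype B] [Fintype C] [DecidableEq C]
    (t : ℝ) (X : Matrix (A × B) (A × B) ℂ) (ρ σ : Matrix (A × B × C) (A × B × C) ℂ) :
    ssaJ t ρ σ (ssaE X) = ssaJ t (mAB ρ) (mAB σ) X := by
  simp only [ssaJ, ← ssaE_conj, ← ssaE_mul, ssaE_trace]

theorem ssa_mAB_one {A B C : Type*} [Fintype A] [Fintype B] [Fintype C] [DecidableEq A]
    (ρ : Matrix (A × B × C) (A × B × C) ℂ) :
    mAB ((1 : Matrix A A ℂ) ⊗ₖ ptL ρ) = (1 : Matrix A A ℂ) ⊗ₖ ptL (mAB ρ) := by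
  ext ⟨a, b⟩ ⟨a', b'⟩
  simp only [mAB, ptL, Matrix.of_apply, Matrix.kroneckerMap_apply, ← Finset.mul_sum]
  rw [Finset.sum_comm, Finset.mul_sum]

theorem ssa_kron {A m : Type*} [Fintype A] [Fintype m] [DecidableEq A] [DecidableEq m]
    {σ V : Matrix m m ℂ} {q : m → ℝ} (h3 : V * Vᴴ = 1) (h4 : Vᴴ * V = 1)
    (hσ : σ = V * diagonal (fun i => (q i : ℂ)) * Vᴴ) :
    ((1 : Matrix A A ℂ) ⊗ₖ V) * ((1 : Matrix A A ℂ) ⊗ₖ V)ᴴ = 1 ∧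
    ((1 : Matrix A A ℂ) ⊗ₖ V)ᴴ * ((1 : Matrix A A ℂ) ⊗ₖ V) = 1 ∧
    (1 : Matrix A A ℂ) ⊗ₖ σ = ((1 : Matrix A A ℂ) ⊗ₖ V) *
      diagonal (fun i : A × m => (q i.2 : ℂ)) * ((1 : Matrix A A ℂ) ⊗ₖ V)ᴴ := by
  have hd : diagonal (fun i : A × m => (q i.2 : ℂ)) =
      (1 : Matrix A A ℂ) ⊗ₖ diagonal (fun i => (q i : ℂ)) := by
    rw [← Matrix.diagonal_one, Matrix.diagonal_kronecker_diagonal]; simp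
  rw [hd, Matrix.conjTranspose_kronecker]
  simp only [← Matrix.mul_kronecker_mul, h3, h4, ← hσ, Matrix.conjTranspose_one, Matrix.one_mul]
  simp

/-- strong subadditivity for positive definite operators, in coordinates -/
theorem ssa_pos {A B C : Type*}
    [Fintype A] [Fintype B] [Fintype C] [DecidableEq A] [DecidableEq B] [DecidableEq C]
    {ρ U : Matrix (A × B × C) (A × B × C) ℂ} {p : A × B × C → ℝ}
    {V : Matrix (B × C) (B × C) ℂ} {q : B × C → ℝ}
    {U' : Matrix (A × B) (A × B) ℂ} {p' : A × B → ℝ}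
    {V' : Matrix B B ℂ} {q' : B → ℝ}
    (hU1 : U * Uᴴ = 1) (hU2 : Uᴴ * U = 1) (hV1 : V * Vᴴ = 1) (hV2 : Vᴴ * V = 1)
    (hU1' : U' * U'ᴴ = 1) (hU2' : U'ᴴ * U' = 1) (hV1' : V' * V'ᴴ = 1) (hV2' : V'ᴴ * V' = 1)
    (hp : ∀ i, 0 < p i) (hq : ∀ i, 0 < q i) (hp' : ∀ i, 0 < p' i) (hq' : ∀ i, 0 < q' i)
    (e1 : ρ = U * diagonal (fun i => (p i : ℂ)) * Uᴴ)
    (e2 : ptL ρ = V * diagonal (fun i => (q i : ℂ)) * Vᴴ)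
    (e3 : mAB ρ = U' * diagonal (fun i => (p' i : ℂ)) * U'ᴴ)
    (e4 : ptL (mAB ρ) = V' * diagonal (fun i => (q' i : ℂ)) * V'ᴴ) :
    - (∑ i, Real.negMulLog (p' i)) + ∑ i, Real.negMulLog (q' i) ≤
    - (∑ i, Real.negMulLog (p i)) + ∑ i, Real.negMulLog (q i) := by
  rw [← ssa_entropy hU2 hV1 hV2 e1 e2, ← ssa_entropy hU2' hV1' hV2' e3 e4]
  obtain ⟨k1, k2, k3⟩ := ssa_kron (A := A) hV1 hV2 e2
  obtain ⟨l1, l2, l3⟩ := ssa_kron (A := A) hV1' hV2' e4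
  refine ssaD_mono _ _ _ hp (fun j => hq j.2) _ _ _ hp' (fun j => hq' j.2) ?_ ?_
  · intro t ht
    obtain ⟨X, hX⟩ := ssaJ_attain hU2' l2 hp' (fun j => hq' j.2) e3 l3 ht
    rw [← hX, ← ssa_mAB_one, ← ssaE_J]
    exact ssaJ_le hU1 hU2 k1 k2 hp (fun j => hq j.2) e1 k3 ht _
  · rw [ssa_csum l1 e3, ssa_csum k1 e1]
    congr 1
    simp [Matrix.trace, mAB, Fintype.sum_prod_type]

theorem ssa_mAB_psd {A B C : Type*} [Fintype A] [Fintype B] [Fintype C]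
    {ρ : Matrix (A × B × C) (A × B × C) ℂ} (h : ρ.PosSemidef) : (mAB ρ).PosSemidef := by
  have : mAB ρ = ∑ k : C, ρ.submatrix (fun i : A × B => (i.1, i.2, k)) (fun i => (i.1, i.2, k)) := by
    ext i j; simp [mAB, Matrix.sum_apply]
  rw [this]
  exact Matrix.posSemidef_sum _ fun k _ => h.submatrix _

theorem ssa_ptL_psd {A B : Type*} [Fintype A] [Fintype B]
    {ρ : Matrix (A × B) (A × B) ℂ} (h : ρ.PosSemidef) : (ptL ρ).PosSemidef := by
  have : ptL ρ = ∑ k : A, ρ.submatrix (fun i : B => (k, i)) (fun i => (k, i)) := by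
    ext i j; simp [ptL, Matrix.sum_apply]
  rw [this]
  exact Matrix.posSemidef_sum _ fun k _ => h.submatrix _

theorem ssa_mAB_shift {A B C : Type*} [Fintype A] [Fintype B] [Fintype C]
    [DecidableEq A] [DecidableEq B] [DecidableEq C]
    (ρ : Matrix (A × B × C) (A × B × C) ℂ) (e : ℝ) :
    mAB (ρ + (e : ℂ) • (1 : Matrix (A × B × C) (A × B × C) ℂ)) =
      mAB ρ + ((Fintype.card C * e : ℝ) : ℂ) • (1 : Matrix (A × B) (A × B) ℂ) := by
  ext ⟨a, b⟩ ⟨a', b'⟩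
  by_cases h : a = a' ∧ b = b'
  · obtain ⟨rfl, rfl⟩ := h
    simp [mAB, Finset.sum_add_distrib]
  · simp [mAB, Finset.sum_add_distrib, Matrix.one_apply, Prod.mk.injEq, h]

theorem ssa_ptL_shift {A B : Type*} [Fintype A] [Fintype B]
    [DecidableEq A] [DecidableEq B]
    (ρ : Matrix (A × B) (A × B) ℂ) (e : ℝ) :
    ptL (ρ + (e : ℂ) • (1 : Matrix (A × B) (A × B) ℂ)) =
      ptL ρ + ((Fintype.card A * e : ℝ) : ℂ) • (1 : Matrix B B ℂ) := by
  ext b b'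
  by_cases h : b = b'
  · subst h
    simp [ptL, Finset.sum_add_distrib]
  · simp [ptL, Finset.sum_add_distrib, Matrix.one_apply, Prod.mk.injEq, h]

theorem ssa_tendsto {n : Type*} [Fintype n] (p : n → ℝ) (r : ℝ) :
    Filter.Tendsto (fun e : ℝ => ∑ i, Real.negMulLog (p i + r * e)) (nhdsWithin 0 (Set.Ioi 0))
      (nhds (∑ i, Real.negMulLog (p i))) := by
  have : Continuous (fun e : ℝ => ∑ i, Real.negMulLog (p i + r * e)) := by
    refine continuous_finsetSum _ fun i _ => Real.continuous_negMulLog.comp (by fun_prop)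
  have h := (this.tendsto 0).mono_left (nhdsWithin_le_nhds (s := Set.Ioi 0))
  simpa using h

/-- Strong subadditivity in mutual-information form: `I(A;BC) ≥ I(A;B)`, i.e. quantum
mutual information is monotone under partial trace. -/
theorem mi_monotone_partial_trace {A B C : Type*}
    [Fintype A] [Fintype B] [Fintype C] [DecidableEq A] [DecidableEq B] [DecidableEq C]
    (ρ : Matrix (A × B × C) (A × B × C) ℂ) (hρ : IsState ρ) :
    MI (mAB ρ) ≤ MI ρ := by
  obtain ⟨hpsd, htr⟩ := hρ
  have hne : Nonempty (A × B × C) := by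
    by_contra h
    rw [not_nonempty_iff] at h
    simp [Matrix.trace] at htr
  obtain ⟨a0, b0, c0⟩ := hne
  have hA : (0 : ℝ) < Fintype.card A := by
    exact_mod_cast Fintype.card_pos_iff.2 ⟨a0⟩
  have hC : (0 : ℝ) < Fintype.card C := by
    exact_mod_cast Fintype.card_pos_iff.2 ⟨c0⟩
  have hpt : ptR (mAB ρ) = ptR ρ := by
    ext i j; simp [ptR, mAB, Fintype.sum_prod_type]
  obtain ⟨U, p, hU1, hU2, hp, e1⟩ := ssa_spec hpsd
  obtain ⟨V, q, hV1, hV2, hq, e2⟩ := ssa_spec (ssa_ptL_psd hpsd)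
  obtain ⟨U', p', hU1', hU2', hp', e3⟩ := ssa_spec (ssa_mAB_psd hpsd)
  obtain ⟨V', q', hV1', hV2', hq', e4⟩ := ssa_spec (ssa_ptL_psd (ssa_mAB_psd hpsd))
  have main : - (∑ i, Real.negMulLog (p' i)) + ∑ i, Real.negMulLog (q' i) ≤
      - (∑ i, Real.negMulLog (p i)) + ∑ i, Real.negMulLog (q i) := by
    refine le_of_tendsto_of_tendsto
      ((ssa_tendsto p' (Fintype.card C)).neg.add (ssa_tendsto q' (Fintype.card A * Fintype.card C)))
      ((ssa_tendsto p 1).neg.add (ssa_tendsto q (Fintype.card A))) ?_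
    filter_upwards [self_mem_nhdsWithin] with e he
    have he : 0 < e := he
    refine ssa_pos (ρ := ρ + ((1 * e : ℝ) : ℂ) • (1 : Matrix (A × B × C) (A × B × C) ℂ))
      hU1 hU2 hV1 hV2 hU1' hU2' hV1' hV2'
      (fun i => by have := hp i; positivity) (fun i => by have := hq i; positivity)
      (fun i => by have := hp' i; positivity) (fun i => by have := hq' i; positivity)
      (ssa_shift hU1 e1 _) ?_ ?_ ?_
    · rw [ssa_ptL_shift, one_mul]; exact ssa_shift hV1 e2 _
    · rw [ssa_mAB_shift, one_mul]; exact ssa_shift hU1' e3 _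
    · rw [ssa_mAB_shift, ssa_ptL_shift, one_mul, ← mul_assoc]; exact ssa_shift hV1' e4 _
  rw [MI, MI, hpt, ssa_vN_eq hU1 hU2 e1, ssa_vN_eq hV1 hV2 e2, ssa_vN_eq hU1' hU2' e3,
    ssa_vN_eq hV1' hV2' e4]
  linarith
end
end
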